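/- arXiv:1604.00113 — 12 statements merged into one kernel-verified Lean document; each statement's English description precedes it below -/
import Mathlib

section
/- Let g, h : ℝ^n → ℝ be max-plus polynomial functions and let r = g − h (a tropical rational function). Then there exist finitely many open sets U_1, …, U_k ⊆ ℝ^n whose closures cover ℝ^n (i.e., ℝ^n = closure(U_1) ∪ … ∪ closure(U_k)) and affine functions A_1, …, A_k : ℝ^n → ℝ such that r coincides with A_i on closure(U_i) for each i. -/
/-- A max-plus polynomial function on `ℝ^N`:
`f x = max_{1 ≤ i ≤ m} (a_i + Σ_j c_{i,j} x_j)` with `a_i ∈ ℝ` and `c_{i,j} ∈ ℕ`. -/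
def IsMaxPlusPoly (N : ℕ) (f : (Fin N → ℝ) → ℝ) : Prop :=
  ∃ (m : ℕ) (a : Fin (m + 1) → ℝ) (c : Fin (m + 1) → Fin N → ℕ),
    ∀ x, f x = ⨆ i, (a i + ∑ j, (c i j : ℝ) * x j)

/-- At every point a max-plus polynomial function agrees with one of finitely many affine
functions, and the set where it agrees with a given one of them is closed. -/
theorem IsMaxPlusPoly.exists_affine_pieces {N : ℕ} {f : (Fin N → ℝ) → ℝ}
    (hf : IsMaxPlusPoly N f) :
    ∃ (m : ℕ) (b : Fin (m + 1) → ℝ) (c : Fin (m + 1) → Fin N → ℝ),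
      (∀ i, IsClosed {x | f x = ∑ j, c i j * x j + b i}) ∧
      ∀ x, ∃ i, f x = ∑ j, c i j * x j + b i := by
  obtain ⟨m, a, c, hf⟩ := hf
  refine ⟨m, a, fun i j => c i j, fun i => ?_, fun x => ?_⟩
  · have hset : {x | f x = ∑ j, (c i j : ℝ) * x j + a i} =
        ⋂ l, {x | a l + ∑ j, (c l j : ℝ) * x j ≤ ∑ j, (c i j : ℝ) * x j + a i} := by
      ext x
      simp only [Set.mem_ofPred_eq, Set.mem_iInter, hf]
      constructor
      · intro h l
        exact h ▸ le_ciSup (f := fun l => a l + ∑ j, (c l j : ℝ) * x j)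
          (Set.finite_range _).bddAbove l
      · intro h
        refine le_antisymm (ciSup_le h) ?_
        rw [add_comm]
        exact le_ciSup (f := fun l => a l + ∑ j, (c l j : ℝ) * x j)
          (Set.finite_range _).bddAbove i
    rw [hset]
    exact isClosed_iInter fun l => isClosed_le (by fun_prop) (by fun_prop)
  · obtain ⟨i, hi⟩ := exists_eq_ciSup_of_finite
      (f := fun i => a i + ∑ j, (c i j : ℝ) * x j)
    exact ⟨i, by rw [hf, ← hi, add_comm]⟩

/-- A tropical rational function `r = g - h` gives a decomposition of `ℝ^n` into closures
of finitely many open sets, covering `ℝ^n`, on each of which `r` is affine. -/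
theorem tropical_rational_affine_decomposition (n : ℕ) (g h : (Fin n → ℝ) → ℝ)
    (hg : IsMaxPlusPoly n g) (hh : IsMaxPlusPoly n h) :
    ∃ (k : ℕ) (U : Fin (k + 1) → Set (Fin n → ℝ))
      (c : Fin (k + 1) → Fin n → ℝ) (b : Fin (k + 1) → ℝ),
      (∀ i, IsOpen (U i)) ∧
      (⋃ i, closure (U i)) = Set.univ ∧
      ∀ i, ∀ x ∈ closure (U i), g x - h x = ∑ j, c i j * x j + b i := by
  obtain ⟨m, a, c, hclosed, hcover⟩ := hg.exists_affine_pieces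
  obtain ⟨m', a', c', hclosed', hcover'⟩ := hh.exists_affine_pieces
  let e : Fin (m + 1) × Fin (m' + 1) ≃ Fin ((m + 1) * m' + m + 1) := finProdFinEquiv
  let C : Fin ((m + 1) * m' + m + 1) → Set (Fin n → ℝ) := fun i =>
    {x | g x = ∑ j, c (e.symm i).1 j * x j + a (e.symm i).1} ∩
      {x | h x = ∑ j, c' (e.symm i).2 j * x j + a' (e.symm i).2}
  have hC : ∀ i, IsClosed (C i) := fun i => (hclosed _).inter (hclosed' _)
  have hU : ⋃ i, C i = Set.univ := by
    refine Set.eq_univ_of_forall fun x => ?_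
    obtain ⟨i, hi⟩ := hcover x
    obtain ⟨i', hi'⟩ := hcover' x
    exact Set.mem_iUnion.2 ⟨e (i, i'), by simpa [C] using ⟨hi, hi'⟩⟩
  refine ⟨(m + 1) * m' + m, fun i => interior (C i),
    fun i j => c (e.symm i).1 j - c' (e.symm i).2 j,
    fun i => a (e.symm i).1 - a' (e.symm i).2, fun i => isOpen_interior, ?_, fun i x hx => ?_⟩
  · rw [← closure_iUnion_of_finite]
    exact (dense_iUnion_interior_of_closed hC hU).closure_eq
  · obtain ⟨hxg, hxh⟩ := closure_minimal interior_subset (hC i) hx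
    simp only [Set.mem_ofPred_eq] at hxg hxh
    rw [hxg, hxh]
    simp only [sub_mul, Finset.sum_sub_distrib]
    ring
end

section
/- Every symmetric max-plus polynomial function can be written as a max-plus polynomial in the elementary symmetric max-plus polynomials: if f : ℝ^n → ℝ is a max-plus polynomial function satisfying f(x_{π(1)}, …, x_{π(n)}) = f(x_1, …, x_n) for every permutation π of {1, …, n}, then there exists a max-plus polynomial function g : ℝ^n → ℝ such that f(x) = g(σ_1(x), …, σ_n(x)) for all x ∈ ℝ^n, where σ_k(x) = max over all k-element subsets S of {1, …, n} of Σ_{j∈S} x_j. -/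
/-- The `k`-th elementary symmetric max-plus polynomial on `ℝ^n`:
the maximum over all `k`-element subsets `S` of `{1, …, n}` of `Σ_{j ∈ S} x_j`. -/
noncomputable def elemSymMaxPlus (n k : ℕ) (x : Fin n → ℝ) : ℝ :=
  sSup { y | ∃ S : Finset (Fin n), S.card = k ∧ y = ∑ j ∈ S, x j }

/-- Every finite tuple can be permuted into a weakly decreasing one. -/
theorem exists_perm_antitone {α : Type*} [LinearOrder α] {n : ℕ} (f : Fin n → α) :
    ∃ ρ : Equiv.Perm (Fin n), Antitone fun j => f (ρ j) :=
  ⟨Tuple.sort (OrderDual.toDual ∘ f), fun _ _ h =>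
    Tuple.monotone_sort (OrderDual.toDual ∘ f) h⟩

/-- Among the index sets of a given size, an initial segment maximizes the sum of a weakly
decreasing tuple. -/
theorem sum_le_sum_Iic_of_antitone {n : ℕ} {z : Fin n → ℝ} (hz : Antitone z) (k : Fin n)
    {S : Finset (Fin n)} (hS : S.card = k + 1) :
    ∑ j ∈ S, z j ≤ ∑ j ∈ Finset.Iic k, z j := by
  have h : ∑ j ∈ S, (z j - z k) ≤ ∑ j ∈ Finset.Iic k, (z j - z k) := by
    rw [← Finset.sum_inter_add_sum_sdiff S (Finset.Iic k)]
    have h₁ : ∑ j ∈ S \ Finset.Iic k, (z j - z k) ≤ 0 :=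
      Finset.sum_nonpos fun j hj => by
        simp only [Finset.mem_sdiff, Finset.mem_Iic, not_le] at hj
        exact sub_nonpos.2 (hz hj.2.le)
    have h₂ : ∑ j ∈ S ∩ Finset.Iic k, (z j - z k) ≤ ∑ j ∈ Finset.Iic k, (z j - z k) :=
      Finset.sum_le_sum_of_subset_of_nonneg Finset.inter_subset_right fun j hj _ =>
        sub_nonneg.2 (hz (Finset.mem_Iic.1 hj))
    linarith
  simpa [Finset.sum_sub_distrib, hS] using h

/-- The value of `elemSymMaxPlus` is attained at the largest entries. -/
theorem isGreatest_elemSymMaxPlus {n : ℕ} {x : Fin n → ℝ} {ρ : Equiv.Perm (Fin n)}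
    (hρ : Antitone fun j => x (ρ j)) (k : Fin n) :
    IsGreatest {y | ∃ S : Finset (Fin n), S.card = (k : ℕ) + 1 ∧ y = ∑ j ∈ S, x j}
      (∑ j ∈ Finset.Iic k, x (ρ j)) := by
  refine ⟨⟨(Finset.Iic k).map ρ.toEmbedding, by simp, by simp⟩, ?_⟩
  rintro _ ⟨S, hS, rfl⟩
  have h := sum_le_sum_Iic_of_antitone hρ k (S := S.map ρ.symm.toEmbedding) (by simpa using hS)
  simpa using h

theorem elemSymMaxPlus_eq_sum_Iic {n : ℕ} {x : Fin n → ℝ} {ρ : Equiv.Perm (Fin n)}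
    (hρ : Antitone fun j => x (ρ j)) (k : Fin n) :
    elemSymMaxPlus n ((k : ℕ) + 1) x = ∑ j ∈ Finset.Iic k, x (ρ j) :=
  (isGreatest_elemSymMaxPlus hρ k).csSup_eq

theorem sum_Iic_le_elemSymMaxPlus {n : ℕ} (x : Fin n → ℝ) (τ : Equiv.Perm (Fin n))
    (k : Fin n) : ∑ j ∈ Finset.Iic k, x (τ j) ≤ elemSymMaxPlus n ((k : ℕ) + 1) x := by
  obtain ⟨ρ, hρ⟩ := exists_perm_antitone x
  rw [elemSymMaxPlus_eq_sum_Iic hρ]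
  exact (isGreatest_elemSymMaxPlus hρ k).2
    ⟨(Finset.Iic k).map τ.toEmbedding, by simp, by simp⟩

/-- Summation by parts. -/
theorem sum_range_sub_mul_sum (D X : ℕ → ℝ) (n : ℕ) :
    ∑ k ∈ Finset.range n, (D k - D (k + 1)) * ∑ j ∈ Finset.range (k + 1), X j
      = ∑ j ∈ Finset.range n, D j * X j - D n * ∑ j ∈ Finset.range n, X j := by
  induction n with
  | zero => simp
  | succ n ih =>
    rw [Finset.sum_range_succ, ih, Finset.sum_range_succ X n,
      Finset.sum_range_succ (fun j => D j * X j)]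
    ring

/-- A weakly decreasing tuple of naturals is a natural combination of indicators of initial
segments. -/
theorem exists_sum_mul_sum_Iic {n : ℕ} {d : Fin n → ℕ} (hd : Antitone d) :
    ∃ e : Fin n → ℕ, ∀ z : Fin n → ℝ,
      ∑ k, (e k : ℝ) * ∑ j ∈ Finset.Iic k, z j = ∑ j, (d j : ℝ) * z j := by
  let D : ℕ → ℕ := fun m => if h : m < n then d ⟨m, h⟩ else 0
  have hD : ∀ j : Fin n, D j = d j := fun j => by simp [D]
  have hDle : ∀ k, D (k + 1) ≤ D k := fun k => by
    by_cases h : k + 1 < n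
    · simp only [D, h, Nat.lt_of_succ_lt h, dif_pos]
      exact hd (by simp)
    · simp [D, h]
  refine ⟨fun k => D k - D (k + 1), fun z => ?_⟩
  let X : ℕ → ℝ := fun m => if h : m < n then z ⟨m, h⟩ else 0
  have hX : ∀ j : Fin n, z j = X j := fun j => by simp [X]
  have hIic : ∀ k : Fin n,
      ∑ j ∈ Finset.Iic k, X j = ∑ j ∈ Finset.range ((k : ℕ) + 1), X j := fun k => by
    rw [Nat.range_succ_eq_Iic, ← Fin.map_valEmbedding_Iic, Finset.sum_map]
    rfl
  have hDn : D n = 0 := by simp [D]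
  have h := sum_range_sub_mul_sum (fun m => (D m : ℝ)) X n
  simp only [hDn, Nat.cast_zero, zero_mul, sub_zero] at h
  simp only [hX, ← hD, hIic, Nat.cast_sub (hDle _)]
  rw [Fin.sum_univ_eq_sum_range (fun k => ((D k : ℝ) - D (k + 1)) *
    ∑ j ∈ Finset.range (k + 1), X j), h, Fin.sum_univ_eq_sum_range (fun j => (D j : ℝ) * X j)]

/-- Fundamental theorem of symmetric max-plus polynomials: every symmetric max-plus
polynomial function is a max-plus polynomial in the elementary symmetric max-plus
polynomials `σ_1, …, σ_n`. -/
theorem symmetric_maxplus_fundamental (n : ℕ) (f : (Fin n → ℝ) → ℝ)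
    (hf : IsMaxPlusPoly n f)
    (hsym : ∀ (π : Equiv.Perm (Fin n)) (x : Fin n → ℝ), f (fun i => x (π i)) = f x) :
    ∃ g : (Fin n → ℝ) → ℝ, IsMaxPlusPoly n g ∧
      ∀ x, f x = g (fun k => elemSymMaxPlus n ((k : ℕ) + 1) x) := by
  obtain ⟨m, a, c, hf⟩ := hf
  choose τ hτ using fun i => exists_perm_antitone (c i)
  choose e he using fun i => exists_sum_mul_sum_Iic (hτ i)
  have hc : ∀ i (w : Fin n → ℝ),
      ∑ j, (c i (τ i j) : ℝ) * w j = ∑ j, (c i j : ℝ) * w ((τ i).symm j) := fun i w => by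
    rw [← Equiv.sum_comp (τ i) fun j => (c i j : ℝ) * w ((τ i).symm j)]
    simp
  refine ⟨fun y => ⨆ i, (a i + ∑ j, (e i j : ℝ) * y j), ⟨m, a, e, fun _ => rfl⟩, fun x => ?_⟩
  apply le_antisymm
  · rw [hf]
    refine ciSup_mono (Set.finite_range _).bddAbove fun i => ?_
    have h : ∑ j, (c i j : ℝ) * x j = ∑ j, (c i (τ i j) : ℝ) * x (τ i j) := by
      simp [hc i fun j => x (τ i j)]
    rw [h, ← he i]
    gcongr
    exact sum_Iic_le_elemSymMaxPlus x (τ i) _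
  · obtain ⟨ρ, hρ⟩ := exists_perm_antitone x
    refine ciSup_le fun i => ?_
    simp only [elemSymMaxPlus_eq_sum_Iic hρ]
    rw [he i, hc i fun j => x (ρ j), ← hsym ((τ i).symm.trans ρ) x, hf]
    exact le_ciSup (f := fun l => a l + ∑ j, (c l j : ℝ) * x (((τ i).symm.trans ρ) j))
      (Set.finite_range _).bddAbove i
end

section
/- The elementary 2-symmetric max-plus polynomials separate orbits: let ((x_1, y_1), …, (x_n, y_n)) and ((x_1', y_1'), …, (x_n', y_n')) be tuples of pairs of real numbers. If σ_E(x_1, y_1, …, x_n, y_n) = σ_E(x_1', y_1', …, x_n', y_n') for every matrix E = (e_{i,1}, e_{i,2})_{1≤i≤n} with entries in {0,1} that is not identically zero, then there exists a permutation π of {1, …, n} such that x_i' = x_{π(i)} and y_i' = y_{π(i)} for all i. -/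
/-- The elementary 2-symmetric max-plus polynomial attached to a 0-1 matrix
`E = (e_{i,1}, e_{i,2})_{1 ≤ i ≤ n}`: the maximum over all permutations `π` of
`Σ_i (e_{i,1} x_{π(i)} + e_{i,2} y_{π(i)})`. -/
noncomputable def sigmaE (n : ℕ) (E : Fin n → Bool × Bool) (x y : Fin n → ℝ) : ℝ :=
  ⨆ π : Equiv.Perm (Fin n),
    ∑ i, ((if (E i).1 then x (π i) else 0) + (if (E i).2 then y (π i) else 0))

open Finset Filter Topology

section AlternatingSup

variable {L : Type*} [Fintype L] [DecidableEq L] [Nonempty L]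

/-- The alternating sum over `T ⊆ L` of the maxima of `d + ε 1_T`, which detects whether all
entries of `d` tie for the maximum. -/
noncomputable def alternatingSup (d : L → ℝ) (ε : ℝ) : ℝ :=
  ∑ T : Finset L, (-1 : ℝ) ^ #T * ⨆ l, (d l + if l ∈ T then ε else 0)

lemma iSup_le_iSup_of_dominated {f g : L → ℝ} {j k : L} (hjk : j ≠ k)
    (hfg : ∀ l, l ≠ j → f l = g l) (hf : f j ≤ f k) : ⨆ l, f l ≤ ⨆ l, g l := by
  have hg : BddAbove (Set.range g) := Set.finite_range g |>.bddAbove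
  refine ciSup_le fun l => ?_
  by_cases hl : l = j
  · subst hl
    exact hf.trans ((hfg k hjk.symm).le.trans (le_ciSup hg k))
  · exact (hfg l hl).le.trans (le_ciSup hg l)

lemma alternatingSup_eq_zero {d : L → ℝ} {ε : ℝ} (hε : 0 < ε) {j k : L} (h : d j + ε ≤ d k) :
    alternatingSup d ε = 0 := by
  have hjk : j ≠ k := by
    rintro rfl
    linarith
  have hdom (T : Finset L) :
      d j + (if j ∈ T then ε else 0) ≤ d k + (if k ∈ T then ε else 0) := by
    split_ifs <;> linarith
  have key (T : Finset L) (hT : j ∉ T) :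
      ⨆ l, (d l + if l ∈ insert j T then ε else 0) = ⨆ l, (d l + if l ∈ T then ε else 0) :=
    le_antisymm
      (iSup_le_iSup_of_dominated hjk (fun l hl => by simp [hl]) (hdom _))
      (iSup_le_iSup_of_dominated hjk (fun l hl => by simp [hl]) (hdom _))
  have huniv : (univ : Finset (Finset L)) = (insert j (univ.erase j)).powerset := by
    simp
  rw [alternatingSup, huniv, sum_powerset_insert (notMem_erase j univ), ← sum_add_distrib]
  refine sum_eq_zero fun T hT => ?_
  have hj : j ∉ T := fun hj => notMem_erase j univ (mem_powerset.1 hT hj)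
  rw [key T hj, card_insert_of_notMem hj]
  ring

lemma alternatingSup_zero {ε : ℝ} (hε : 0 < ε) :
    alternatingSup (0 : L → ℝ) ε = -ε := by
  have hsup (T : Finset L) :
      ⨆ l, ((0 : L → ℝ) l + if l ∈ T then ε else 0) = ε - if T = ∅ then ε else 0 := by
    rcases T.eq_empty_or_nonempty with rfl | ⟨k, hk⟩
    · simp
    · rw [if_neg (ne_empty_of_mem hk), sub_zero]
      refine le_antisymm (ciSup_le fun l => ?_) ?_
      · rw [Pi.zero_apply, zero_add]
        split_ifs <;> linarith
      · refine le_ciSup_of_le (Set.finite_range _).bddAbove k ?_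
        simp [hk]
  have halt : ∑ T : Finset L, (-1 : ℝ) ^ #T = 0 := by
    have := sum_powerset_neg_one_pow_card_of_nonempty (univ_nonempty (α := L))
    rw [powerset_univ] at this
    exact_mod_cast this
  simp_rw [alternatingSup, hsup, mul_sub, sum_sub_distrib, ← sum_mul, halt]
  simp

end AlternatingSup

/-- The linear form on `ℝ × ℝ` with 0-1 coefficients `l`. -/
def rowValue (l : Bool × Bool) (p : ℝ × ℝ) : ℝ :=
  (if l.1 then p.1 else 0) + (if l.2 then p.2 else 0)

lemma sum_iSup_rowValue_le {n : ℕ} {x y x' y' : Fin n → ℝ}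
    (h : ∀ E, sigmaE n E x y ≤ sigmaE n E x' y') (u : Bool × Bool → ℝ) :
    ∑ i, ⨆ l, (rowValue l (x i, y i) + u l) ≤ ∑ i, ⨆ l, (rowValue l (x' i, y' i) + u l) := by
  choose E hE using fun i =>
    exists_eq_ciSup_of_finite (f := fun l => rowValue l (x i, y i) + u l)
  obtain ⟨π, hπ⟩ := exists_eq_ciSup_of_finite
    (f := fun π : Equiv.Perm (Fin n) => ∑ i, rowValue (E i) (x' (π i), y' (π i)))
  calc ∑ i, ⨆ l, (rowValue l (x i, y i) + u l)
      = ∑ i, rowValue (E i) (x i, y i) + ∑ i, u (E i) := by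
        rw [← sum_add_distrib]
        exact sum_congr rfl fun i _ => (hE i).symm
    _ ≤ sigmaE n E x y + ∑ i, u (E i) := by
        gcongr
        exact le_ciSup (f := fun π : Equiv.Perm (Fin n) =>
          ∑ i, rowValue (E i) (x (π i), y (π i))) (Set.finite_range _).bddAbove 1
    _ ≤ sigmaE n E x' y' + ∑ i, u (E i) := by
        gcongr
        exact h E
    _ = ∑ i, (rowValue (E i) (x' (π i), y' (π i)) + u (E i)) := by
        rw [sum_add_distrib]
        exact congrArg (· + _) hπ.symm
    _ ≤ ∑ i, ⨆ l, (rowValue l (x' (π i), y' (π i)) + u l) :=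
        sum_le_sum fun i _ => le_ciSup
          (f := fun l => rowValue l (x' (π i), y' (π i)) + u l) (Set.finite_range _).bddAbove (E i)
    _ = ∑ i, ⨆ l, (rowValue l (x' i, y' i) + u l) :=
        Equiv.sum_comp π fun i => ⨆ l, (rowValue l (x' i, y' i) + u l)

lemma exists_rowValue_gap {p q : ℝ × ℝ} {ε : ℝ} (h : ε ≤ dist p q) :
    ∃ j k, rowValue j p - rowValue j q + ε ≤ rowValue k p - rowValue k q := by
  rw [Prod.dist_eq, Real.dist_eq, Real.dist_eq] at h
  rcases le_max_iff.1 h with h | h <;> rcases le_abs.1 h with h | h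
  · exact ⟨(false, false), (true, false), by simp [rowValue]; linarith⟩
  · exact ⟨(true, false), (false, false), by simp [rowValue]; linarith⟩
  · exact ⟨(false, false), (false, true), by simp [rowValue]; linarith⟩
  · exact ⟨(false, true), (false, false), by simp [rowValue]; linarith⟩

lemma alternatingSup_rowValue_sub {p q : ℝ × ℝ} {ε : ℝ} (hε : 0 < ε)
    (h : p ≠ q → ε ≤ dist p q) :
    alternatingSup (fun l => rowValue l p - rowValue l q) ε = if p = q then -ε else 0 := by
  split_ifs with hpq
  · subst hpq
    simp_rw [sub_self]
    exact alternatingSup_zero hε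
  · obtain ⟨j, k, hjk⟩ := exists_rowValue_gap (h hpq)
    exact alternatingSup_eq_zero hε hjk

lemma eventually_forall_le_dist {ι : Type*} [Finite ι] (f : ι → ℝ × ℝ) (q : ℝ × ℝ) :
    ∀ᶠ ε in 𝓝[>] (0 : ℝ), ∀ i, f i ≠ q → ε ≤ dist (f i) q := by
  refine eventually_all.2 fun i => ?_
  by_cases hi : f i = q
  · simp [hi]
  · filter_upwards [Ioo_mem_nhdsGT (dist_pos.2 hi)] with ε hε _ using hε.2.le

/-- Tuples with equal sums of maxima of shifted linear forms contain every point equally often. -/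
lemma card_fiber_eq_of_sum_iSup_eq {ι : Type*} [Fintype ι] {f g : ι → ℝ × ℝ}
    (h : ∀ u : Bool × Bool → ℝ,
      ∑ i, ⨆ l, (rowValue l (f i) + u l) = ∑ i, ⨆ l, (rowValue l (g i) + u l))
    (q : ℝ × ℝ) : #{i | f i = q} = #{i | g i = q} := by
  obtain ⟨ε, ⟨hf, hg⟩, hε⟩ := (((eventually_forall_le_dist f q).and
    (eventually_forall_le_dist g q)).and self_mem_nhdsWithin).exists
  have hε : 0 < ε := hε
  have hsum (e : ι → ℝ × ℝ) (he : ∀ i, e i ≠ q → ε ≤ dist (e i) q) :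
      ∑ T : Finset (Bool × Bool), (-1 : ℝ) ^ #T *
        ∑ i, ⨆ l, (rowValue l (e i) + (-rowValue l q + if l ∈ T then ε else 0)) =
      #{i | e i = q} * -ε := by
    simp_rw [mul_sum]
    rw [sum_comm, ← nsmul_eq_mul, ← sum_const, sum_filter]
    refine sum_congr rfl fun i _ => ?_
    rw [← alternatingSup_rowValue_sub hε (he i), alternatingSup]
    simp_rw [sub_eq_add_neg, add_assoc]
  have := hsum f hf
  simp_rw [h, hsum g hg] at this
  exact_mod_cast (mul_right_cancel₀ (neg_ne_zero.2 hε.ne') this).symm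

/-- The elementary 2-symmetric max-plus polynomials separate orbits of the row
permutation action of `Sₙ` on `ℝ^{2n}`. -/
theorem sigmaE_separates_orbits (n : ℕ) (hn : 1 ≤ n)
    (x y x' y' : Fin n → ℝ)
    (h : ∀ E : Fin n → Bool × Bool, (∃ i, E i ≠ (false, false)) →
      sigmaE n E x y = sigmaE n E x' y') :
    ∃ π : Equiv.Perm (Fin n), ∀ i, x' i = x (π i) ∧ y' i = y (π i) := by
  have hall (E : Fin n → Bool × Bool) : sigmaE n E x y = sigmaE n E x' y' := by
    by_cases hE : ∃ i, E i ≠ (false, false)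
    · exact h E hE
    · push Not at hE
      simp [sigmaE, hE]
  have hcard := card_fiber_eq_of_sum_iSup_eq (f := fun i => (x i, y i))
    (g := fun i => (x' i, y' i)) fun u =>
      (sum_iSup_rowValue_le (fun E => (hall E).le) u).antisymm
        (sum_iSup_rowValue_le (fun E => (hall E).ge) u)
  let e (q : ℝ × ℝ) : {i // (x' i, y' i) = q} ≃ {i // (x i, y i) = q} :=
    Fintype.equivOfCardEq (by simpa only [Fintype.card_subtype] using (hcard q).symm)
  exact ⟨Equiv.ofFiberEquiv e, fun i => Prod.ext_iff.1 (Equiv.ofFiberEquiv_map e i).symm⟩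
end

section
/- Let p : ℝ^{2n} → ℝ, with arguments written (x_1, d_1, …, x_n, d_n), be given by a minimal max-plus representation p = max_{1≤i≤m} (a_i + Σ_{j=1}^n (α_{i,j} x_j + β_{i,j} d_j)) where a_i ∈ ℝ, α_{i,j}, β_{i,j} ∈ ℕ, and minimality means: for each i there exists a point z ∈ ℝ^{2n} at which the i-th term strictly exceeds every other term. Fix j. Then the restriction of p to W_j = {(x_1, d_1, …, x_n, d_n) ∈ [0,∞)^{2n} : d_j = 0} is independent of the coordinate x_j if and only if α_{i,j} = 0 for all i = 1, …, m. -/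
/-- Let `p(x, d) = max_{1 ≤ i ≤ m} (a_i + Σ_j (α_{i,j} x_j + β_{i,j} d_j))` be a minimal
max-plus representation (each term strictly dominates all others somewhere).  Then `p`
restricted to `W_j = {(x, d) ∈ [0,∞)^{2n} : d_j = 0}` is independent of `x_j` if and
only if `α_{i,j} = 0` for all `i`. -/
theorem minimal_maxplus_restriction_independent_iff (n m : ℕ)
    (a : Fin (m + 1) → ℝ) (α β : Fin (m + 1) → Fin n → ℕ) (j : Fin n)
    (hmin : ∀ i : Fin (m + 1), ∃ x d : Fin n → ℝ, ∀ i', i' ≠ i →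
      a i' + ∑ j', ((α i' j' : ℝ) * x j' + (β i' j' : ℝ) * d j') <
        a i + ∑ j', ((α i j' : ℝ) * x j' + (β i j' : ℝ) * d j')) :
    ((∀ x x' d : Fin n → ℝ,
        (∀ i, 0 ≤ x i) → (∀ i, 0 ≤ x' i) → (∀ i, 0 ≤ d i) → d j = 0 →
        (∀ i, i ≠ j → x i = x' i) →
        (⨆ i, (a i + ∑ j', ((α i j' : ℝ) * x j' + (β i j' : ℝ) * d j'))) =
          (⨆ i, (a i + ∑ j', ((α i j' : ℝ) * x' j' + (β i j' : ℝ) * d j')))) ↔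
      ∀ i, α i j = 0) := by
  constructor
  · intro h i
    by_contra hi
    set S : ℝ := ⨆ k, a k with hS
    have haS : a i ≤ S := le_ciSup (f := a) (Set.finite_range a).bddAbove i
    have hα : (1 : ℝ) ≤ α i j := by exact_mod_cast Nat.one_le_iff_ne_zero.mpr hi
    have ht : 0 ≤ S - a i + 1 := by linarith
    -- Moving far enough along the `x_j` axis makes the `i`-th term exceed the value at the origin.
    have key := h 0 (Pi.single j (S - a i + 1)) 0 (fun _ => le_rfl)
      (fun k => by rw [Pi.single_apply]; split_ifs <;> linarith) (fun _ => le_rfl) rfl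
      (fun k hk => by simp [hk])
    simp only [Pi.single_apply, Pi.zero_apply, mul_zero, add_zero, Finset.sum_const_zero,
      mul_ite, Finset.sum_ite_eq', Finset.mem_univ, if_true] at key
    have hle := le_ciSup (f := fun k => a k + (α k j : ℝ) * (S - a i + 1))
      (Set.finite_range _).bddAbove i
    simp only [← key, ← hS] at hle
    nlinarith
  · intro h x x' d _ _ _ _ hx
    congr! 5 with i k
    by_cases hk : k = j
    · simp [hk, h i]
    · rw [hx k hk]
end

section
/- Let p : ℝ^{2n} → ℝ, with arguments written (x_1, d_1, …, x_n, d_n), be a max-plus polynomial function such that for every j = 1, …, n the restriction of p to W_j = {(x_1, d_1, …, x_n, d_n) ∈ [0,∞)^{2n} : d_j = 0} is independent of the coordinate x_j. Then there exist m ≥ 1, real numbers a_1, …, a_m and natural numbers β_{i,j} such that p(x_1, d_1, …, x_n, d_n) = max_{1≤i≤m} (a_i + Σ_{j=1}^n β_{i,j} d_j) for all (x_1, d_1, …, x_n, d_n) ∈ ℝ^{2n}. -/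
/-- A max-plus polynomial function on `ℝ^{2n}`, with arguments written as two blocks
`(x_1, …, x_n)` and `(d_1, …, d_n)`:
`f x d = max_{1 ≤ i ≤ m} (a_i + Σ_j (α_{i,j} x_j + β_{i,j} d_j))`. -/
def IsMaxPlusPoly2 (n : ℕ) (f : (Fin n → ℝ) → (Fin n → ℝ) → ℝ) : Prop :=
  ∃ (m : ℕ) (a : Fin (m + 1) → ℝ) (α β : Fin (m + 1) → Fin n → ℕ),
    ∀ x d, f x d = ⨆ i, (a i + ∑ j, ((α i j : ℝ) * x j + (β i j : ℝ) * d j))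

/-- If a max-plus polynomial function `p(x_1, d_1, …, x_n, d_n)`, restricted to
`W_j = {(x, d) ∈ [0,∞)^{2n} : d_j = 0}`, is independent of `x_j` for every `j`, then
`p` has a max-plus representation involving only the variables `d_1, …, d_n`. -/
theorem maxplus_independent_of_births (n : ℕ) (p : (Fin n → ℝ) → (Fin n → ℝ) → ℝ)
    (hp : IsMaxPlusPoly2 n p)
    (hind : ∀ j : Fin n, ∀ x x' d : Fin n → ℝ,
      (∀ i, 0 ≤ x i) → (∀ i, 0 ≤ x' i) → (∀ i, 0 ≤ d i) → d j = 0 →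
      (∀ i, i ≠ j → x i = x' i) → p x d = p x' d) :
    ∃ (m : ℕ) (a : Fin (m + 1) → ℝ) (β : Fin (m + 1) → Fin n → ℕ),
      ∀ x d, p x d = ⨆ i, (a i + ∑ j, (β i j : ℝ) * d j) := by
  obtain ⟨m, a, α, β, hf⟩ := hp
  have hα : ∀ i j, α i j = 0 := by
    intro i j
    by_contra h
    have h1 : (1 : ℝ) ≤ α i j := by exact_mod_cast Nat.one_le_iff_ne_zero.mpr h
    set t : ℝ := |p 0 0 - a i| + 1
    have ht0 : 0 ≤ t := by positivity
    have hx : (0 : Fin n → ℝ) ≤ Pi.single j t := Pi.single_nonneg.mpr ht0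
    have hconst : p (Pi.single j t) 0 = p 0 0 :=
      hind j _ _ _ hx (fun _ => le_rfl) (fun _ => le_rfl) rfl (fun k hk => by simp [hk])
    have hle : a i + ∑ k, ((α i k : ℝ) * (Pi.single j t : Fin n → ℝ) k
        + (β i k : ℝ) * (0 : Fin n → ℝ) k) ≤ p (Pi.single j t) 0 := by
      rw [hf]
      exact le_ciSup (f := fun i => a i + ∑ k, ((α i k : ℝ) * (Pi.single j t : Fin n → ℝ) k
        + (β i k : ℝ) * (0 : Fin n → ℝ) k)) (Set.finite_range _).bddAbove i
    have hsum : ∑ k, ((α i k : ℝ) * (Pi.single j t : Fin n → ℝ) k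
        + (β i k : ℝ) * (0 : Fin n → ℝ) k) = α i j * t := by
      simp [Pi.single_apply]
    rw [hsum, hconst] at hle
    have := le_abs_self (p 0 0 - a i)
    nlinarith
  exact ⟨m, a, β, fun x d => by simp [hf, hα]⟩
end

section
/- For any pair of barcodes B_1 and B_2 and any n ≥ 1, the difference between the total length of the n longest bars of B_1 and of B_2 is bounded by 2n times the bottleneck distance: |σ_{(0,1)^n}(B_1) − σ_{(0,1)^n}(B_2)| ≤ 2n · d_∞(B_1, B_2). -/
/-- Distance between two intervals given as (left endpoint, length):
`d_∞((x₁,d₁),(x₂,d₂)) = max(|x₁ − x₂|, |d₁ − d₂ + x₁ − x₂|)`. -/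
def intervalDist (I J : ℝ × ℝ) : ℝ := max |I.1 - J.1| |I.2 - J.2 + I.1 - J.1|

/-- A partial matching between two barcodes (finite multisets of intervals), encoded
as a multiset of matched pairs: the first components form a submultiset of `B₁`, the
second components a submultiset of `B₂`. -/
def IsMatching (B₁ B₂ : Multiset (ℝ × ℝ)) (M : Multiset ((ℝ × ℝ) × (ℝ × ℝ))) : Prop :=
  M.map Prod.fst ≤ B₁ ∧ M.map Prod.snd ≤ B₂

/-- The bottleneck penalty `P_∞(θ)` of a partial matching: the maximum of the interval
distances of matched pairs and of `d/2` over all unmatched intervals `(x, d)`. -/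
noncomputable def penaltyInf (B₁ B₂ : Multiset (ℝ × ℝ))
    (M : Multiset ((ℝ × ℝ) × (ℝ × ℝ))) : ℝ :=
  ((M.map fun IJ : (ℝ × ℝ) × (ℝ × ℝ) => intervalDist IJ.1 IJ.2) +
      (((B₁ - M.map Prod.fst) + (B₂ - M.map Prod.snd)).map
        fun I : ℝ × ℝ => I.2 / 2)).fold max 0

/-- The bottleneck distance between two barcodes. -/
noncomputable def bottleneckDist (B₁ B₂ : Multiset (ℝ × ℝ)) : ℝ :=
  sInf { r | ∃ M, IsMatching B₁ B₂ M ∧ r = penaltyInf B₁ B₂ M }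

/-- The `q`-th Wasserstein penalty `P_q(θ)` of a partial matching. -/
noncomputable def penaltyP (q : ℝ) (B₁ B₂ : Multiset (ℝ × ℝ))
    (M : Multiset ((ℝ × ℝ) × (ℝ × ℝ))) : ℝ :=
  (M.map fun IJ : (ℝ × ℝ) × (ℝ × ℝ) => intervalDist IJ.1 IJ.2 ^ q).sum +
    ((((B₁ - M.map Prod.fst) + (B₂ - M.map Prod.snd)).map
      fun I : ℝ × ℝ => (I.2 / 2) ^ q)).sum

/-- The `q`-th Wasserstein distance between two barcodes. -/
noncomputable def wassersteinDist (q : ℝ) (B₁ B₂ : Multiset (ℝ × ℝ)) : ℝ :=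
  (sInf { r | ∃ M, IsMatching B₁ B₂ M ∧ r = penaltyP q B₁ B₂ M }) ^ (1 / q)

/-- `sigmaN n B` = `σ_{(0,1)ⁿ}(B)`: the sum of the `n` largest lengths of intervals
of `B` (for barcodes, i.e. multisets of pairs of nonnegative reals, the supremum below
is exactly the sum of the `n` largest lengths, counting missing intervals as 0). -/
noncomputable def sigmaN (n : ℕ) (B : Multiset (ℝ × ℝ)) : ℝ :=
  sSup { r | ∃ s : Multiset ℝ, s ≤ B.map Prod.snd ∧ s.card ≤ n ∧ r = s.sum }

theorem Multiset.exists_le_map_eq_of_le_map {α β : Type*} {f : α → β} {s : Multiset β}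
    {t : Multiset α} (h : s ≤ t.map f) : ∃ u ≤ t, u.map f = s := by
  classical
  induction t using Multiset.induction_on generalizing s with
  | empty => exact ⟨0, le_rfl, by simpa using (h.antisymm (Multiset.zero_le _)).symm⟩
  | cons a t ih =>
    rw [Multiset.map_cons] at h
    by_cases ha : f a ∈ s
    · obtain ⟨u, hu, he⟩ := ih (Multiset.erase_le_iff_le_cons.2 h)
      exact ⟨a ::ₘ u, Multiset.cons_le_cons a hu, by
        rw [Multiset.map_cons, he, Multiset.cons_erase ha]⟩
    · obtain ⟨u, hu, he⟩ := ih ((Multiset.le_cons_of_notMem ha).1 h)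
      exact ⟨u, hu.trans (Multiset.le_cons_self t a), he⟩

theorem Multiset.le_fold_max {α : Type*} [LinearOrder α] (b : α) (s : Multiset α) :
    b ≤ s.fold max b ∧ ∀ a ∈ s, a ≤ s.fold max b := by
  induction s using Multiset.induction_on with
  | empty => simp
  | cons a s ih =>
    simp only [Multiset.fold_cons_left, Multiset.mem_cons, le_max_iff, forall_eq_or_imp]
    exact ⟨Or.inr ih.1, Or.inl le_rfl, fun x hx => Or.inr (ih.2 x hx)⟩

theorem sum_le_sigmaN {n : ℕ} {B : Multiset (ℝ × ℝ)} {s : Multiset ℝ}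
    (hs : s ≤ B.map Prod.snd) (hn : s.card ≤ n) : s.sum ≤ sigmaN n B := by
  classical
  refine le_csSup (Set.Finite.bddAbove ?_) ⟨s, hs, hn, rfl⟩
  refine (((B.map Prod.snd).powerset.toFinset.finite_toSet).image Multiset.sum).subset ?_
  rintro _ ⟨t, ht, -, rfl⟩
  exact ⟨t, by simpa using ht, rfl⟩

theorem sigmaN_le_add_of_matching {n : ℕ} {B₁ B₂ : Multiset (ℝ × ℝ)}
    {M : Multiset ((ℝ × ℝ) × (ℝ × ℝ))} {c : ℝ} (hM : IsMatching B₁ B₂ M) (hc : 0 ≤ c)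
    (hmatched : ∀ IJ ∈ M, IJ.1.2 ≤ IJ.2.2 + c)
    (hunmatched : ∀ I ∈ B₁ - M.map Prod.fst, I.2 ≤ c) :
    sigmaN n B₁ ≤ sigmaN n B₂ + n * c := by
  refine csSup_le ⟨0, 0, Multiset.zero_le _, by simp, by simp⟩ ?_
  rintro _ ⟨s, hs, hsn, rfl⟩
  obtain ⟨A, hA, rfl⟩ := Multiset.exists_le_map_eq_of_le_map hs
  obtain ⟨N, hN, hNA⟩ :=
    Multiset.exists_le_map_eq_of_le_map (Multiset.inter_le_right (s := A) (t := M.map Prod.fst))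
  have hsplit : A = N.map Prod.fst + (A - M.map Prod.fst) := by
    rw [hNA]
    ext I
    simp only [Multiset.count_add, Multiset.count_inter, Multiset.count_sub]
    omega
  have hcard : N.card + (A - M.map Prod.fst).card ≤ n := by
    have h := congrArg Multiset.card hsplit
    simp only [Multiset.card_add, Multiset.card_map] at h hsn
    omega
  have hsum : (N.map fun IJ => IJ.1.2).sum ≤ (N.map fun IJ => IJ.2.2).sum + N.card * c := by
    have h := Multiset.sum_map_le_sum_map (s := N) (fun IJ => IJ.1.2) (fun IJ => IJ.2.2 + c)
      fun IJ h => hmatched IJ (Multiset.mem_of_le hN h)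
    simpa [Multiset.sum_map_add] using h
  have hrest : ((A - M.map Prod.fst).map Prod.snd).sum ≤ (A - M.map Prod.fst).card * c := by
    have h := Multiset.sum_le_card_nsmul ((A - M.map Prod.fst).map Prod.snd) c (by
      intro d hd
      obtain ⟨I, hI, rfl⟩ := Multiset.mem_map.1 hd
      exact hunmatched I (Multiset.mem_of_le (tsub_le_tsub_right hA _) hI))
    simpa using h
  have hsigma : (N.map fun IJ => IJ.2.2).sum ≤ sigmaN n B₂ := by
    refine sum_le_sigmaN ?_ (by rw [Multiset.card_map]; omega)
    have h := Multiset.map_le_map (f := Prod.snd) ((Multiset.map_le_map hN).trans hM.2)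
    simpa [Multiset.map_map, Function.comp_def] using h
  have hn : ((N.card : ℝ) + (A - M.map Prod.fst).card) * c ≤ n * c :=
    mul_le_mul_of_nonneg_right (by exact_mod_cast hcard) hc
  have hAsum : (A.map Prod.snd).sum =
      (N.map fun IJ => IJ.1.2).sum + ((A - M.map Prod.fst).map Prod.snd).sum := by
    conv_lhs => rw [hsplit]
    simp [Multiset.map_map]
  linarith

theorem abs_length_sub_le_two_mul_intervalDist (I J : ℝ × ℝ) :
    |I.2 - J.2| ≤ 2 * intervalDist I J := by
  have h₁ := abs_le.1 (le_max_left |I.1 - J.1| |I.2 - J.2 + I.1 - J.1|)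
  have h₂ := abs_le.1 (le_max_right |I.1 - J.1| |I.2 - J.2 + I.1 - J.1|)
  unfold intervalDist
  exact abs_le.2 ⟨by linarith, by linarith⟩

theorem IsMatching.abs_sigmaN_sub_le {n : ℕ} {B₁ B₂ : Multiset (ℝ × ℝ)}
    {M : Multiset ((ℝ × ℝ) × (ℝ × ℝ))} (hM : IsMatching B₁ B₂ M) :
    |sigmaN n B₁ - sigmaN n B₂| ≤ n * (2 * penaltyInf B₁ B₂ M) := by
  obtain ⟨hpos, hle⟩ : 0 ≤ penaltyInf B₁ B₂ M ∧ _ := Multiset.le_fold_max 0 _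
  have hmatched : ∀ IJ ∈ M, |IJ.1.2 - IJ.2.2| ≤ 2 * penaltyInf B₁ B₂ M := fun IJ h =>
    (abs_length_sub_le_two_mul_intervalDist _ _).trans <| mul_le_mul_of_nonneg_left
      (hle _ (Multiset.mem_add.2 (Or.inl (Multiset.mem_map_of_mem _ h)))) zero_le_two
  have hunmatched : ∀ I ∈ (B₁ - M.map Prod.fst) + (B₂ - M.map Prod.snd),
      I.2 ≤ 2 * penaltyInf B₁ B₂ M := fun I h => by
    have := hle _ (Multiset.mem_add.2 (Or.inr (Multiset.mem_map_of_mem _ h)))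
    change I.2 / 2 ≤ penaltyInf B₁ B₂ M at this
    linarith
  have h₁₂ := sigmaN_le_add_of_matching (n := n) hM (by positivity)
    (fun IJ h => by linarith [(abs_le.1 (hmatched IJ h)).2])
    fun I h => hunmatched I (Multiset.mem_add.2 (Or.inl h))
  have hswap : IsMatching B₂ B₁ (M.map Prod.swap) := by
    simpa [IsMatching, Multiset.map_map, Function.comp_def] using hM.symm
  have h₂₁ := sigmaN_le_add_of_matching (n := n) (c := 2 * penaltyInf B₁ B₂ M) hswap
    (by positivity)
    (fun IJ h => by
      obtain ⟨JI, hJI, rfl⟩ := Multiset.mem_map.1 h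
      simp only [Prod.fst_swap, Prod.snd_swap]
      linarith [(abs_le.1 (hmatched JI hJI)).1])
    fun I h => hunmatched I (Multiset.mem_add.2 (Or.inr (by
      simpa [Multiset.map_map, Function.comp_def] using h)))
  exact abs_le.2 ⟨by linarith, by linarith⟩

/-- For any pair of barcodes, the difference between the total lengths of the `n`
longest bars is bounded by `2n` times the bottleneck distance. -/
theorem sigmaN_bottleneck_stable (n : ℕ) (hn : 1 ≤ n) (B₁ B₂ : Multiset (ℝ × ℝ))
    (h₁ : ∀ I ∈ B₁, 0 ≤ I.1 ∧ 0 ≤ I.2) (h₂ : ∀ I ∈ B₂, 0 ≤ I.1 ∧ 0 ≤ I.2) :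
    |sigmaN n B₁ - sigmaN n B₂| ≤ 2 * n * bottleneckDist B₁ B₂ := by
  have hpos : (0 : ℝ) < 2 * n := by positivity
  rw [← div_le_iff₀' hpos]
  refine le_csInf ⟨_, 0, ⟨by simp, by simp⟩, rfl⟩ ?_
  rintro _ ⟨M, hM, rfl⟩
  rw [div_le_iff₀' hpos]
  linarith [hM.abs_sigmaN_sub_le (n := n)]
end

section
/- For any pair of barcodes B_1 and B_2, any n ≥ 1 and any real p ≥ 1, |σ_{(0,1)^n}(B_1) − σ_{(0,1)^n}(B_2)| ≤ 2 · n^{(p−1)/p} · d_p(B_1, B_2). -/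
theorem intervalDist_nonneg (I J : ℝ × ℝ) : 0 ≤ intervalDist I J :=
  (abs_nonneg _).trans (le_max_left _ _)

theorem intervalDist_comm (I J : ℝ × ℝ) : intervalDist I J = intervalDist J I := by
  unfold intervalDist
  rw [abs_sub_comm I.1, ← abs_neg (I.2 - J.2 + I.1 - J.1)]
  congr 2
  ring

theorem length_le_length_add_intervalDist (I J : ℝ × ℝ) :
    I.2 ≤ J.2 + 2 * intervalDist I J := by
  have h₁ : |I.1 - J.1| ≤ intervalDist I J := le_max_left _ _
  have h₂ : |I.2 - J.2 + I.1 - J.1| ≤ intervalDist I J := le_max_right _ _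
  have := (abs_le.mp h₁).1
  have := (abs_le.mp h₂).2
  linarith

theorem IsMatching.swap {B₁ B₂ : Multiset (ℝ × ℝ)} {M : Multiset ((ℝ × ℝ) × (ℝ × ℝ))}
    (h : IsMatching B₁ B₂ M) : IsMatching B₂ B₁ (M.map Prod.swap) := by
  simpa [IsMatching, Multiset.map_map] using h.symm

theorem penaltyP_swap (q : ℝ) (B₁ B₂ : Multiset (ℝ × ℝ)) (M : Multiset ((ℝ × ℝ) × (ℝ × ℝ))) :
    penaltyP q B₂ B₁ (M.map Prod.swap) = penaltyP q B₁ B₂ M := by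
  simp only [penaltyP, Multiset.map_map, Function.comp_def, Prod.fst_swap, Prod.snd_swap]
  congr 1
  · simp only [intervalDist_comm]
  · rw [add_comm]

theorem Multiset.sum_le_sum_of_le_of_nonneg {s t : Multiset ℝ} (h : s ≤ t)
    (ht : ∀ x ∈ t, 0 ≤ x) : s.sum ≤ t.sum := by
  obtain ⟨u, rfl⟩ := Multiset.le_iff_exists_add.mp h
  rw [Multiset.sum_add]
  have := Multiset.sum_nonneg (s := u) fun x hx => ht x (Multiset.mem_add.mpr (Or.inr hx))
  linarith

/-- Power mean inequality for multisets of nonnegative reals. -/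
theorem Multiset.sum_rpow_le_card_rpow_mul_sum_rpow {p : ℝ} (hp : 1 ≤ p) (s : Multiset ℝ)
    (hs : ∀ x ∈ s, 0 ≤ x) :
    s.sum ^ p ≤ (s.card : ℝ) ^ (p - 1) * (s.map (· ^ p)).sum := by
  induction s using Quotient.inductionOn with
  | h l =>
    have h := Real.rpow_sum_le_const_mul_sum_rpow_of_nonneg (Finset.univ : Finset (Fin l.length))
      (f := fun i => l[i]) hp fun i _ => hs _ (by simp)
    have e : ∑ i : Fin l.length, l[i] ^ p = (l.map (· ^ p)).sum :=
      Fin.sum_univ_fun_getElem l (· ^ p)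
    rw [e] at h
    simpa [Fin.sum_univ_getElem] using h

theorem bddAbove_sum_le_length {B : Multiset (ℝ × ℝ)} (h : ∀ I ∈ B, 0 ≤ I.2) (n : ℕ) :
    BddAbove { r | ∃ s : Multiset ℝ, s ≤ B.map Prod.snd ∧ s.card ≤ n ∧ r = s.sum } := by
  refine ⟨(B.map Prod.snd).sum, ?_⟩
  rintro _ ⟨s, hs, -, rfl⟩
  refine Multiset.sum_le_sum_of_le_of_nonneg hs fun x hx => ?_
  obtain ⟨I, hI, rfl⟩ := Multiset.mem_map.mp hx
  exact h I hI

theorem nonneg_of_mem_penaltyP_summands (p : ℝ) {B₁ B₂ : Multiset (ℝ × ℝ)}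
    (h₁ : ∀ I ∈ B₁, 0 ≤ I.2) (h₂ : ∀ I ∈ B₂, 0 ≤ I.2) (M : Multiset ((ℝ × ℝ) × (ℝ × ℝ))) :
    ∀ x ∈ M.map (fun IJ => intervalDist IJ.1 IJ.2 ^ p) +
      ((B₁ - M.map Prod.fst) + (B₂ - M.map Prod.snd)).map (fun I => (I.2 / 2) ^ p), 0 ≤ x := by
  intro x hx
  rcases Multiset.mem_add.mp hx with hx | hx <;> obtain ⟨I, hI, rfl⟩ := Multiset.mem_map.mp hx
  · exact Real.rpow_nonneg (intervalDist_nonneg _ _) _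
  · refine Real.rpow_nonneg (div_nonneg ?_ zero_le_two) _
    rcases Multiset.mem_add.mp hI with hI | hI
    · exact h₁ I (Multiset.mem_of_le tsub_le_self hI)
    · exact h₂ I (Multiset.mem_of_le tsub_le_self hI)

theorem penaltyP_nonneg (p : ℝ) {B₁ B₂ : Multiset (ℝ × ℝ)} (h₁ : ∀ I ∈ B₁, 0 ≤ I.2)
    (h₂ : ∀ I ∈ B₂, 0 ≤ I.2) (M : Multiset ((ℝ × ℝ) × (ℝ × ℝ))) : 0 ≤ penaltyP p B₁ B₂ M := by
  rw [penaltyP, ← Multiset.sum_add]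
  exact Multiset.sum_nonneg (nonneg_of_mem_penaltyP_summands p h₁ h₂ M)

/-- A submultiset of `B` splits along a multiset of matched pairs into a matched and an
unmatched part. -/
theorem exists_eq_map_fst_add_of_le {B S : Multiset (ℝ × ℝ)}
    (M : Multiset ((ℝ × ℝ) × (ℝ × ℝ))) (hS : S ≤ B) :
    ∃ N V, N ≤ M ∧ V ≤ B - M.map Prod.fst ∧ S = N.map Prod.fst + V := by
  obtain ⟨N, hN, hNS⟩ : ∃ N ≤ M, N.map Prod.fst = S ∩ M.map Prod.fst :=
    Multiset.exists_le_map_eq_of_le_map Multiset.inter_le_right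
  refine ⟨N, S - M.map Prod.fst, hN, tsub_le_tsub_right hS _, ?_⟩
  rw [hNS, add_comm, Multiset.sub_add_inter]

theorem IsMatching.sum_length_le {p : ℝ} (hp : 1 ≤ p) {n : ℕ}
    {B₁ B₂ S : Multiset (ℝ × ℝ)} {M : Multiset ((ℝ × ℝ) × (ℝ × ℝ))}
    (h₁ : ∀ I ∈ B₁, 0 ≤ I.2) (h₂ : ∀ I ∈ B₂, 0 ≤ I.2)
    (hM : IsMatching B₁ B₂ M) (hS : S ≤ B₁) (hn : S.card ≤ n) :
    (S.map Prod.snd).sum ≤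
      sigmaN n B₂ + 2 * ((n : ℝ) ^ ((p - 1) / p) * penaltyP p B₁ B₂ M ^ (1 / p)) := by
  have hp0 : 0 < p := by linarith
  obtain ⟨N, V, hN, hV, rfl⟩ := exists_eq_map_fst_add_of_le M hS
  rw [Multiset.card_add, Multiset.card_map] at hn
  set W : Multiset ℝ := N.map (fun IJ => intervalDist IJ.1 IJ.2) + V.map (fun I => I.2 / 2)
    with hW
  have hW0 : ∀ x ∈ W, 0 ≤ x := by
    intro x hx
    rcases Multiset.mem_add.mp hx with hx | hx <;> obtain ⟨I, hI, rfl⟩ := Multiset.mem_map.mp hx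
    · exact intervalDist_nonneg _ _
    · exact div_nonneg (h₁ I (Multiset.mem_of_le (hV.trans tsub_le_self) hI)) zero_le_two
  have hWsum : W.sum ≤ (n : ℝ) ^ ((p - 1) / p) * penaltyP p B₁ B₂ M ^ (1 / p) := by
    have hWp : (W.map (· ^ p)).sum ≤ penaltyP p B₁ B₂ M := by
      rw [hW, penaltyP, ← Multiset.sum_add]
      refine Multiset.sum_le_sum_of_le_of_nonneg ?_ (nonneg_of_mem_penaltyP_summands p h₁ h₂ M)
      simp only [Multiset.map_add, Multiset.map_map, Function.comp_def]
      refine add_le_add (Multiset.map_le_map hN) ?_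
      exact (Multiset.map_le_map hV).trans (Multiset.le_add_right _ _)
    have hcard : (W.card : ℝ) ≤ n := by
      rw [hW, Multiset.card_add, Multiset.card_map, Multiset.card_map]
      exact_mod_cast hn
    have hpow : W.sum ^ p ≤ (n : ℝ) ^ (p - 1) * penaltyP p B₁ B₂ M :=
      (Multiset.sum_rpow_le_card_rpow_mul_sum_rpow hp W hW0).trans <|
        mul_le_mul (Real.rpow_le_rpow (Nat.cast_nonneg _) hcard (by linarith)) hWp
          (Multiset.sum_nonneg (by
            intro x hx
            obtain ⟨y, hy, rfl⟩ := Multiset.mem_map.mp hx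
            exact Real.rpow_nonneg (hW0 y hy) _))
          (by positivity)
    have hroot := Real.rpow_le_rpow
      (Real.rpow_nonneg (Multiset.sum_nonneg hW0) _) hpow (one_div_nonneg.mpr hp0.le)
    rwa [← Real.rpow_mul (Multiset.sum_nonneg hW0), mul_one_div_cancel hp0.ne', Real.rpow_one,
      Real.mul_rpow (by positivity) (penaltyP_nonneg p h₁ h₂ M),
      ← Real.rpow_mul (Nat.cast_nonneg _), mul_one_div] at hroot
  have hσ : (N.map fun IJ => IJ.2.2).sum ≤ sigmaN n B₂ := by
    refine le_csSup (bddAbove_sum_le_length h₂ n) ⟨_, ?_, ?_, rfl⟩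
    · simpa [Multiset.map_map, Function.comp_def] using
        Multiset.map_le_map (f := Prod.snd) ((Multiset.map_le_map (f := Prod.snd) hN).trans hM.2)
    · rw [Multiset.card_map]
      omega
  have hNle : (N.map fun IJ => IJ.1.2).sum ≤
      (N.map fun IJ => IJ.2.2 + 2 * intervalDist IJ.1 IJ.2).sum :=
    Multiset.sum_map_le_sum_map _ _ fun IJ _ => length_le_length_add_intervalDist IJ.1 IJ.2
  rw [Multiset.sum_map_add, Multiset.sum_map_mul_left] at hNle
  have hWeq : W.sum = (N.map fun IJ => intervalDist IJ.1 IJ.2).sum + (V.map Prod.snd).sum / 2 := by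
    rw [hW, Multiset.sum_add, Multiset.sum_map_div]
  rw [Multiset.map_add, Multiset.sum_add, Multiset.map_map]
  simp only [Function.comp_def]
  linarith

theorem sigmaN_sub_le_wassersteinDist {n : ℕ} (hn : 1 ≤ n) {p : ℝ} (hp : 1 ≤ p)
    {B₁ B₂ : Multiset (ℝ × ℝ)} (h₁ : ∀ I ∈ B₁, 0 ≤ I.2) (h₂ : ∀ I ∈ B₂, 0 ≤ I.2) :
    sigmaN n B₁ - sigmaN n B₂ ≤ 2 * (n : ℝ) ^ ((p - 1) / p) * wassersteinDist p B₁ B₂ := by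
  have hp0 : 0 < p := by linarith
  have hc : 0 < 2 * (n : ℝ) ^ ((p - 1) / p) := by positivity
  have hinf : 0 ≤ sInf { r | ∃ M, IsMatching B₁ B₂ M ∧ r = penaltyP p B₁ B₂ M } := by
    refine Real.sInf_nonneg ?_
    rintro _ ⟨M, -, rfl⟩
    exact penaltyP_nonneg p h₁ h₂ M
  rcases le_total (sigmaN n B₁ - sigmaN n B₂) 0 with h0 | h0
  · exact h0.trans (mul_nonneg hc.le (Real.rpow_nonneg hinf _))
  rw [← div_le_iff₀' hc, wassersteinDist, one_div,
    Real.le_rpow_inv_iff_of_pos (div_nonneg h0 hc.le) hinf hp0]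
  refine le_csInf ⟨_, 0, by simp [IsMatching], rfl⟩ ?_
  rintro _ ⟨M, hM, rfl⟩
  rw [← Real.le_rpow_inv_iff_of_pos (div_nonneg h0 hc.le) (penaltyP_nonneg p h₁ h₂ M) hp0,
    div_le_iff₀' hc, ← one_div, sub_le_iff_le_add', mul_assoc]
  refine csSup_le ⟨_, 0, by simp, by simp, rfl⟩ ?_
  rintro _ ⟨s, hs, hcard, rfl⟩
  obtain ⟨S, hS, rfl⟩ := Multiset.exists_le_map_eq_of_le_map hs
  rw [Multiset.card_map] at hcard
  exact hM.sum_length_le hp h₁ h₂ hS hcard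

theorem wassersteinDist_comm (q : ℝ) (B₁ B₂ : Multiset (ℝ × ℝ)) :
    wassersteinDist q B₁ B₂ = wassersteinDist q B₂ B₁ := by
  unfold wassersteinDist
  congr 2
  ext r
  constructor <;> rintro ⟨M, hM, rfl⟩ <;> exact ⟨_, hM.swap, (penaltyP_swap _ _ _ _).symm⟩

/-- For any pair of barcodes, any `n ≥ 1` and any real `p ≥ 1`, the difference of the
total lengths of the `n` longest bars is bounded by `2 · n^{(p−1)/p}` times the `p`-th
Wasserstein distance. -/
theorem sigmaN_wasserstein_stable (n : ℕ) (hn : 1 ≤ n) (p : ℝ) (hp : 1 ≤ p)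
    (B₁ B₂ : Multiset (ℝ × ℝ))
    (h₁ : ∀ I ∈ B₁, 0 ≤ I.1 ∧ 0 ≤ I.2) (h₂ : ∀ I ∈ B₂, 0 ≤ I.1 ∧ 0 ≤ I.2) :
    |sigmaN n B₁ - sigmaN n B₂| ≤ 2 * (n : ℝ) ^ ((p - 1) / p) * wassersteinDist p B₁ B₂ := by
  refine abs_sub_le_iff.mpr ⟨sigmaN_sub_le_wassersteinDist hn hp (fun I hI => (h₁ I hI).2)
    fun I hI => (h₂ I hI).2, ?_⟩
  rw [wassersteinDist_comm]
  exact sigmaN_sub_le_wassersteinDist hn hp (fun I hI => (h₂ I hI).2) fun I hI => (h₁ I hI).2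
end

section
/- No finite family of tropical rational functions separates barcodes with n bars: fix n ≥ 1, and let f_1, …, f_m : ℝ^{2n} → ℝ be tropical rational functions (each f_i = g_i − h_i with g_i, h_i max-plus polynomial functions) such that each f_i is constant on the equivalence classes of ∼ restricted to [0,∞)^{2n}. Then there exist points v, w ∈ [0,∞)^{2n} with v not equivalent to w under ∼ but f_i(v) = f_i(w) for all i = 1, …, m. -/
/-- A tropical rational function on `ℝ^{2n}`: a difference of two max-plus polynomial
functions. -/
def IsTropicalRational2 (n : ℕ) (f : (Fin n → ℝ) → (Fin n → ℝ) → ℝ) : Prop :=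
  ∃ g h, IsMaxPlusPoly2 n g ∧ IsMaxPlusPoly2 n h ∧ ∀ x d, f x d = g x d - h x d

/-- The equivalence relation `∼` on `[0,∞)^{2n}`: `(x, d) ∼ (x', d')` iff some
permutation `π` satisfies `d_i = d'_{π(i)}` for all `i` and `x_i = x'_{π(i)}`
whenever `d_i > 0`. -/
def EquivBar (n : ℕ) (x d x' d' : Fin n → ℝ) : Prop :=
  ∃ π : Equiv.Perm (Fin n), (∀ i, d i = d' (π i)) ∧ ∀ i, 0 < d i → x i = x' (π i)

open Filter

/-- A finite maximum of affine functions of one variable is eventually affine, and its slope at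
infinity is the largest of the slopes. -/
theorem eventually_iSup_affine_eq {ι : Type*} [Finite ι] [Nonempty ι] (A b : ι → ℝ) :
    ∃ c : ℝ, ∀ᶠ t : ℝ in atTop, ⨆ i, (b i + A i * t) = (⨆ i, A i) * t + c := by
  classical
  have := Fintype.ofFinite ι
  obtain ⟨i₀, hi₀⟩ := exists_eq_ciSup_of_finite (f := A)
  obtain ⟨i₁, hi₁, hmax⟩ := (Finset.univ.filter fun i => A i = ⨆ j, A j).exists_max_image b
    ⟨i₀, by simpa using hi₀⟩
  have hA : A i₁ = ⨆ j, A j := by simpa using hi₁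
  refine ⟨b i₁, ?_⟩
  have hle : ∀ᶠ t : ℝ in atTop, ∀ i, b i + A i * t ≤ b i₁ + A i₁ * t := by
    refine eventually_all.2 fun i => ?_
    rcases (le_ciSup (Set.finite_range A).bddAbove i).eq_or_lt with h | h
    · have hb := hmax i (by simpa using h)
      filter_upwards with t
      rw [h, hA]
      linarith
    · rw [← hA] at h
      filter_upwards [eventually_ge_atTop ((b i - b i₁) / (A i₁ - A i))] with t ht
      rw [div_le_iff₀ (sub_pos.2 h)] at ht
      linarith
  filter_upwards [hle] with t ht
  rw [← hA, add_comm]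
  exact le_antisymm (ciSup_le ht)
    (le_ciSup (f := fun i => b i + A i * t) (Set.finite_range _).bddAbove i₁)

/-- On the diagonal, a max-plus polynomial function is eventually affine in the first block, with
a slope that does not depend on the second block. -/
theorem IsMaxPlusPoly2.exists_slope {n : ℕ} {f : (Fin n → ℝ) → (Fin n → ℝ) → ℝ}
    (hf : IsMaxPlusPoly2 n f) :
    ∃ k : ℝ, ∀ d : Fin n → ℝ, ∃ c : ℝ, ∀ᶠ t : ℝ in atTop, f (fun _ => t) d = k * t + c := by
  obtain ⟨m, a, α, β, hf⟩ := hf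
  refine ⟨⨆ i, ∑ j, (α i j : ℝ), fun d => ?_⟩
  obtain ⟨c, hc⟩ := eventually_iSup_affine_eq (fun i => ∑ j, (α i j : ℝ))
    (fun i => a i + ∑ j, (β i j : ℝ) * d j)
  refine ⟨c, hc.mono fun t ht => ?_⟩
  rw [hf, ← ht]
  congr 1
  funext i
  rw [Finset.sum_add_distrib, Finset.sum_mul]
  ring

theorem IsTropicalRational2.exists_slope {n : ℕ} {f : (Fin n → ℝ) → (Fin n → ℝ) → ℝ}
    (hf : IsTropicalRational2 n f) :
    ∃ k : ℝ, ∀ d : Fin n → ℝ, ∃ c : ℝ, ∀ᶠ t : ℝ in atTop, f (fun _ => t) d = k * t + c := by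
  obtain ⟨g, h, hg, hh, hf⟩ := hf
  obtain ⟨k, hk⟩ := hg.exists_slope
  obtain ⟨l, hl⟩ := hh.exists_slope
  refine ⟨k - l, fun d => ?_⟩
  obtain ⟨b, hb⟩ := hk d
  obtain ⟨c, hc⟩ := hl d
  refine ⟨b - c, ?_⟩
  filter_upwards [hb, hc] with t h₁ h₂
  rw [hf, h₁, h₂]
  ring

/-- A tropical rational function that does not depend on the first block when the second block
vanishes is eventually constant along the diagonal of the first block. -/
theorem IsTropicalRational2.eventually_const {n : ℕ} {f : (Fin n → ℝ) → (Fin n → ℝ) → ℝ}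
    (hf : IsTropicalRational2 n f)
    (h0 : ∀ s t : ℝ, 0 ≤ s → 0 ≤ t → f (fun _ => s) 0 = f (fun _ => t) 0) (d : Fin n → ℝ) :
    ∃ c : ℝ, ∀ᶠ t : ℝ in atTop, f (fun _ => t) d = c := by
  obtain ⟨k, hk⟩ := hf.exists_slope
  obtain ⟨b, hb⟩ := hk 0
  obtain ⟨c, hc⟩ := hk d
  obtain ⟨T, hT⟩ := eventually_atTop.1 hb
  have hk0 : k = 0 := by
    have h₁ := hT (max T 0) (le_max_left _ _)
    have h₂ := hT (max T 0 + 1) (by linarith [le_max_left T 0])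
    have h₃ := h0 (max T 0) (max T 0 + 1) (le_max_right _ _) (by linarith [le_max_right T 0])
    linarith
  exact ⟨c, hc.mono fun t ht => by rw [ht, hk0]; ring⟩

/-- No finite family of tropical rational functions that are constant on the
equivalence classes of `∼` on `[0,∞)^{2n}` separates nonequivalent points. -/
theorem no_finite_tropical_rational_separating_family (n : ℕ) (hn : 1 ≤ n) (m : ℕ)
    (f : Fin m → ((Fin n → ℝ) → (Fin n → ℝ) → ℝ))
    (hrat : ∀ i, IsTropicalRational2 n (f i))
    (hconst : ∀ i, ∀ x d x' d' : Fin n → ℝ,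
      (∀ j, 0 ≤ x j) → (∀ j, 0 ≤ d j) → (∀ j, 0 ≤ x' j) → (∀ j, 0 ≤ d' j) →
      EquivBar n x d x' d' → f i x d = f i x' d') :
    ∃ x d x' d' : Fin n → ℝ,
      (∀ j, 0 ≤ x j) ∧ (∀ j, 0 ≤ d j) ∧ (∀ j, 0 ≤ x' j) ∧ (∀ j, 0 ≤ d' j) ∧
      ¬ EquivBar n x d x' d' ∧ ∀ i, f i x d = f i x' d' := by
  have hconst_ev : ∀ i, ∃ c : ℝ, ∀ᶠ t : ℝ in atTop, f i (fun _ => t) 1 = c := fun i =>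
    (hrat i).eventually_const
      (fun s t hs ht => hconst i _ _ _ _ (fun _ => hs) (fun _ => le_rfl) (fun _ => ht)
        (fun _ => le_rfl) ⟨1, fun _ => rfl, fun _ h => absurd h (lt_irrefl _)⟩) 1
  choose c hc using hconst_ev
  obtain ⟨T, hT⟩ := eventually_atTop.1 ((eventually_all.2 hc).and (eventually_ge_atTop 0))
  obtain ⟨hT₁, hT0⟩ := hT T le_rfl
  obtain ⟨hT₂, hT0'⟩ := hT (T + 1) (by linarith)
  refine ⟨fun _ => T, 1, fun _ => T + 1, 1, fun _ => hT0, fun _ => zero_le_one, fun _ => hT0',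
    fun _ => zero_le_one, ?_, fun i => (hT₁ i).trans (hT₂ i).symm⟩
  rintro ⟨π, -, hx⟩
  have := hx ⟨0, hn⟩ one_pos
  linarith
end

section
/- For every positive integer m and every matrix E = (e_{i,1}, e_{i,2})_{1≤i≤n} with entries in {0,1}, not all zero, the function E_{m,E}(x_1, d_1, …, x_n, d_n) = σ_E(min(x_1, m·d_1), d_1, …, min(x_n, m·d_n), d_n), regarded as a function ℝ^{2n} → ℝ, is a tropical rational function (a difference of two max-plus polynomial functions), and it is constant on the equivalence classes of ∼ restricted to [0,∞)^{2n}: if v ∼ w then E_{m,E}(v) = E_{m,E}(w). -/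
/-- `E_{m,E}(x₁, d₁, …, xₙ, dₙ) = σ_E(min(x₁, m·d₁), d₁, …, min(xₙ, m·dₙ), dₙ)`. -/
noncomputable def EmE (n : ℕ) (m : ℕ) (E : Fin n → Bool × Bool)
    (x d : Fin n → ℝ) : ℝ :=
  sigmaE n E (fun i => min (x i) ((m : ℝ) * d i)) d

/-- For a finite nonempty family of reals, being its supremum means being its maximum. -/
theorem eq_iSup_iff_isGreatest {ι : Type*} [Finite ι] [Nonempty ι] (g : ι → ℝ) (c : ℝ) :
    c = ⨆ i, g i ↔ IsGreatest (Set.range g) c := by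
  have h : IsGreatest (Set.range g) (⨆ i, g i) :=
    ⟨exists_eq_ciSup_of_finite, by
      rintro _ ⟨i, rfl⟩
      exact le_ciSup (Set.finite_range g).bddAbove i⟩
  exact ⟨fun hc => hc ▸ h, fun hc => hc.unique h⟩

namespace IsMaxPlusPoly2

variable {n : ℕ} {f g : (Fin n → ℝ) → (Fin n → ℝ) → ℝ}

/-- The monomials of a max-plus polynomial may be indexed by any finite nonempty type. -/
theorem of_isGreatest {ι : Type*} [Finite ι] [Nonempty ι] (a : ι → ℝ) (α β : ι → Fin n → ℕ)
    (h : ∀ x d, IsGreatest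
      (Set.range fun i => a i + ∑ j, ((α i j : ℝ) * x j + (β i j : ℝ) * d j)) (f x d)) :
    IsMaxPlusPoly2 n f := by
  obtain ⟨k, ⟨e⟩⟩ := Finite.exists_equiv_fin ι
  cases k with
  | zero => exact (e (Classical.arbitrary ι)).elim0
  | succ k =>
    refine ⟨k, a ∘ e.symm, α ∘ e.symm, β ∘ e.symm, fun x d => ?_⟩
    rw [(eq_iSup_iff_isGreatest _ _).2 (h x d)]
    exact (e.symm.iSup_comp
      (g := fun i => a i + ∑ j, ((α i j : ℝ) * x j + (β i j : ℝ) * d j))).symm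

theorem of_monomial (α β : Fin n → ℕ) :
    IsMaxPlusPoly2 n fun x d => ∑ j, ((α j : ℝ) * x j + (β j : ℝ) * d j) :=
  of_isGreatest (fun _ : Unit => 0) (fun _ => α) (fun _ => β) fun x d => by
    simp [Set.range_const]

theorem add (hf : IsMaxPlusPoly2 n f) (hg : IsMaxPlusPoly2 n g) :
    IsMaxPlusPoly2 n fun x d => f x d + g x d := by
  obtain ⟨k, a, α, β, hf⟩ := hf
  obtain ⟨l, b, γ, δ, hg⟩ := hg
  refine of_isGreatest (fun p : Fin (k + 1) × Fin (l + 1) => a p.1 + b p.2)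
    (fun p j => α p.1 j + γ p.2 j) (fun p j => β p.1 j + δ p.2 j) fun x d => ?_
  obtain ⟨⟨i, hi⟩, hf⟩ := (eq_iSup_iff_isGreatest _ _).1 (hf x d)
  obtain ⟨⟨i', hi'⟩, hg⟩ := (eq_iSup_iff_isGreatest _ _).1 (hg x d)
  have key : ∀ p : Fin (k + 1) × Fin (l + 1),
      a p.1 + b p.2 + ∑ j, (((α p.1 j + γ p.2 j : ℕ) : ℝ) * x j
        + ((β p.1 j + δ p.2 j : ℕ) : ℝ) * d j) =
      (a p.1 + ∑ j, ((α p.1 j : ℝ) * x j + (β p.1 j : ℝ) * d j)) +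
        (b p.2 + ∑ j, ((γ p.2 j : ℝ) * x j + (δ p.2 j : ℝ) * d j)) := by
    intro p
    rw [add_add_add_comm, ← Finset.sum_add_distrib]
    congr 1
    refine Finset.sum_congr rfl fun j _ => ?_
    push_cast
    ring
  simp only [key]
  refine ⟨⟨(i, i'), congrArg₂ (· + ·) hi hi'⟩, ?_⟩
  rintro _ ⟨p, rfl⟩
  exact add_le_add (hf ⟨p.1, rfl⟩) (hg ⟨p.2, rfl⟩)

theorem max (hf : IsMaxPlusPoly2 n f) (hg : IsMaxPlusPoly2 n g) :
    IsMaxPlusPoly2 n fun x d => Max.max (f x d) (g x d) := by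
  obtain ⟨k, a, α, β, hf⟩ := hf
  obtain ⟨l, b, γ, δ, hg⟩ := hg
  refine of_isGreatest (Sum.elim a b) (Sum.elim α γ) (Sum.elim β δ) fun x d => ?_
  have h := ((eq_iSup_iff_isGreatest _ _).1 (hf x d)).union
    ((eq_iSup_iff_isGreatest _ _).1 (hg x d))
  rw [← Set.Sum.elim_range] at h
  refine Eq.subst (motive := fun S => IsGreatest S _) (congrArg Set.range ?_) h
  funext i
  cases i <;> rfl

end IsMaxPlusPoly2

namespace IsTropicalRational2

variable {n : ℕ} {f g : (Fin n → ℝ) → (Fin n → ℝ) → ℝ}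

theorem of_monomial (α β : Fin n → ℕ) :
    IsTropicalRational2 n fun x d => ∑ j, ((α j : ℝ) * x j + (β j : ℝ) * d j) :=
  ⟨_, _, .of_monomial α β, .of_monomial 0 0, fun x d => by simp⟩

theorem zero : IsTropicalRational2 n fun _ _ => 0 := by
  simpa using of_monomial (n := n) 0 0

theorem fst_apply (i : Fin n) : IsTropicalRational2 n fun x _ => x i := by
  simpa [Pi.single_apply] using of_monomial (n := n) (Pi.single i 1) 0

theorem natCast_mul_snd_apply (m : ℕ) (i : Fin n) :
    IsTropicalRational2 n fun _ d => (m : ℝ) * d i := by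
  simpa [Pi.single_apply] using of_monomial (n := n) 0 (Pi.single i m)

theorem snd_apply (i : Fin n) : IsTropicalRational2 n fun _ d => d i := by
  simpa using natCast_mul_snd_apply 1 i

theorem neg (hf : IsTropicalRational2 n f) : IsTropicalRational2 n fun x d => -f x d := by
  obtain ⟨p, q, hp, hq, h⟩ := hf
  exact ⟨q, p, hq, hp, fun x d => by simp only [h]; ring⟩

theorem add (hf : IsTropicalRational2 n f) (hg : IsTropicalRational2 n g) :
    IsTropicalRational2 n fun x d => f x d + g x d := by
  obtain ⟨p, q, hp, hq, hf⟩ := hf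
  obtain ⟨r, s, hr, hs, hg⟩ := hg
  exact ⟨_, _, hp.add hr, hq.add hs, fun x d => by simp only [hf, hg]; ring⟩

theorem max (hf : IsTropicalRational2 n f) (hg : IsTropicalRational2 n g) :
    IsTropicalRational2 n fun x d => Max.max (f x d) (g x d) := by
  obtain ⟨p, q, hp, hq, hf⟩ := hf
  obtain ⟨r, s, hr, hs, hg⟩ := hg
  refine ⟨_, _, (hp.add hs).max (hr.add hq), hq.add hs, fun x d => ?_⟩
  simp only [hf, hg, ← max_sub_sub_right]
  congr 1 <;> ring

theorem min (hf : IsTropicalRational2 n f) (hg : IsTropicalRational2 n g) :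
    IsTropicalRational2 n fun x d => Min.min (f x d) (g x d) := by
  simpa [max_neg_neg] using (hf.neg.max hg.neg).neg

theorem sum {ι : Type*} (s : Finset ι) {F : ι → (Fin n → ℝ) → (Fin n → ℝ) → ℝ}
    (hF : ∀ i ∈ s, IsTropicalRational2 n (F i)) :
    IsTropicalRational2 n fun x d => ∑ i ∈ s, F i x d := by
  induction s using Finset.cons_induction with
  | empty => simpa using zero
  | cons i s hi ih =>
    simp only [Finset.sum_cons]
    rw [Finset.forall_mem_cons] at hF
    exact hF.1.add (ih hF.2)

theorem sup' {ι : Type*} {s : Finset ι} (hs : s.Nonempty)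
    {F : ι → (Fin n → ℝ) → (Fin n → ℝ) → ℝ} (hF : ∀ i ∈ s, IsTropicalRational2 n (F i)) :
    IsTropicalRational2 n fun x d => s.sup' hs fun i => F i x d := by
  induction hs using Finset.Nonempty.cons_induction with
  | singleton i => simpa using hF
  | cons i s hi hs ih =>
    simp only [Finset.sup'_cons hs]
    rw [Finset.forall_mem_cons] at hF
    exact hF.1.max (ih hF.2)

theorem iSup {ι : Type*} [Fintype ι] [Nonempty ι]
    {F : ι → (Fin n → ℝ) → (Fin n → ℝ) → ℝ} (hF : ∀ i, IsTropicalRational2 n (F i)) :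
    IsTropicalRational2 n fun x d => ⨆ i, F i x d := by
  simp only [← Finset.sup'_univ_eq_ciSup]
  exact sup' _ fun i _ => hF i

end IsTropicalRational2

theorem EmE_isTropicalRational2 (n m : ℕ) (E : Fin n → Bool × Bool) :
    IsTropicalRational2 n (EmE n m E) := by
  unfold EmE sigmaE
  refine .iSup fun π => .sum _ fun i _ => .add ?_ ?_
  · split_ifs
    · exact (IsTropicalRational2.fst_apply _).min (.natCast_mul_snd_apply m _)
    · exact .zero
  · split_ifs
    · exact .snd_apply _
    · exact .zero

/-- `sigmaE` is invariant under simultaneous permutation of its two blocks of variables. -/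
theorem sigmaE_comp_perm (n : ℕ) (E : Fin n → Bool × Bool) (x y : Fin n → ℝ)
    (π : Equiv.Perm (Fin n)) : sigmaE n E (x ∘ π) (y ∘ π) = sigmaE n E x y :=
  (Equiv.mulLeft π).iSup_comp (g := fun τ : Equiv.Perm (Fin n) =>
    ∑ i, ((if (E i).1 then x (τ i) else 0) + (if (E i).2 then y (τ i) else 0)))

theorem EmE_eq_of_equivBar {n m : ℕ} (E : Fin n → Bool × Bool) {x d x' d' : Fin n → ℝ}
    (hx : ∀ j, 0 ≤ x j) (hd : ∀ j, 0 ≤ d j) (hx' : ∀ j, 0 ≤ x' j)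
    (h : EquivBar n x d x' d') : EmE n m E x d = EmE n m E x' d' := by
  obtain ⟨π, hπd, hπx⟩ := h
  unfold EmE
  rw [← sigmaE_comp_perm n E (fun i => min (x' i) (m * d' i)) d' π]
  congr 1
  · funext i
    simp only [Function.comp_apply, ← hπd i]
    rcases (hd i).eq_or_lt with h0 | h0
    · simp [← h0, hx i, hx' (π i)]
    · rw [hπx i h0]
  · exact funext hπd

/-- Each function `E_{m,E}` is a tropical rational function on `ℝ^{2n}`, and it is
constant on the equivalence classes of `∼` restricted to `[0,∞)^{2n}`. -/
theorem EmE_tropical_rational_and_invariant (n : ℕ) (hn : 1 ≤ n) (m : ℕ) (hm : 1 ≤ m)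
    (E : Fin n → Bool × Bool) (hE : ∃ i, E i ≠ (false, false)) :
    IsTropicalRational2 n (EmE n m E) ∧
    ∀ x d x' d' : Fin n → ℝ,
      (∀ j, 0 ≤ x j) → (∀ j, 0 ≤ d j) → (∀ j, 0 ≤ x' j) → (∀ j, 0 ≤ d' j) →
      EquivBar n x d x' d' → EmE n m E x d = EmE n m E x' d' := by
  exact ⟨EmE_isTropicalRational2 n m E, fun _ _ _ _ hx hd hx' _ h =>
    EmE_eq_of_equivBar E hx hd hx' h⟩
end

section
/- The functions E_{m,E} separate nonequivalent points: fix n ≥ 1 and let v, w ∈ [0,∞)^{2n}. If E_{m,E}(v) = E_{m,E}(w) for every positive integer m and every matrix E = (e_{i,1}, e_{i,2})_{1≤i≤n} with entries in {0,1}, not all zero, then v ∼ w. -/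
open Filter Topology in
/-- Away from the apex `s = t = 0`, the odd part of the second-order difference of the tropical
line `(a, b) ↦ max(0, s - a, t - b)` vanishes at small scales; at the apex it equals `-ε`. -/
lemma eventually_tropicalLine_difference (s t : ℝ) :
    ∀ᶠ ε in 𝓝[>] (0 : ℝ),
      max 0 (max (s - ε) t) + max 0 (max s (t - ε)) - max 0 (max (s - ε) (t - ε))
        - (max 0 (max (s + ε) t) + max 0 (max s (t + ε)) - max 0 (max (s + ε) (t + ε)))
      = -(if s = 0 ∧ t = 0 then ε else 0) := by
  have small : ∀ a : ℝ, a ≠ 0 → ∀ᶠ ε in 𝓝[>] (0 : ℝ), ε < |a| := fun a ha =>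
    nhdsWithin_le_nhds (gt_mem_nhds (abs_pos.mpr ha))
  have sector : ∀ a : ℝ, ∀ᶠ ε in 𝓝[>] (0 : ℝ), a = 0 ∨ ε < a ∨ ε < -a := by
    intro a
    by_cases ha : a = 0
    · simp [ha]
    · filter_upwards [small a ha] with ε hε
      exact Or.inr (lt_abs.mp hε)
  filter_upwards [sector s, sector t, sector (s - t), self_mem_nhdsWithin] with ε hs ht hst hε
  have hε : 0 < ε := hε
  rcases hs with hs | hs | hs <;> rcases ht with ht | ht | ht <;>
    rcases hst with hst | hst | hst <;> split_ifs with h0 <;> grind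

/-- The sum over `i` of the tropical lines with apices `(x_i, y_i)`, evaluated at `(p, q)`. -/
noncomputable def tropicalLineSum {n : ℕ} (x y : Fin n → ℝ) (p q : ℝ) : ℝ :=
  ∑ i, max 0 (max (x i - p) (y i - q))

open Filter Topology in
lemma eventually_tropicalLineSum_difference {n : ℕ} (x y : Fin n → ℝ) (p q : ℝ) :
    ∀ᶠ ε in 𝓝[>] (0 : ℝ),
      tropicalLineSum x y (p + ε) q + tropicalLineSum x y p (q + ε)
        - tropicalLineSum x y (p + ε) (q + ε)
        - (tropicalLineSum x y (p - ε) q + tropicalLineSum x y p (q - ε)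
          - tropicalLineSum x y (p - ε) (q - ε))
      = -((Finset.univ.filter fun i => (x i, y i) = (p, q)).card * ε) := by
  filter_upwards [eventually_all.mpr fun i =>
    eventually_tropicalLine_difference (x i - p) (y i - q)] with ε hε
  have hsum := Finset.sum_congr rfl fun i (_ : i ∈ Finset.univ) => hε i
  have hcard : ∑ i, (if x i - p = 0 ∧ y i - q = 0 then ε else 0)
      = (Finset.univ.filter fun i => (x i, y i) = (p, q)).card * ε := by
    rw [← Finset.sum_filter, Finset.sum_const, nsmul_eq_mul]
    congr 3
    ext i
    simp only [Finset.mem_filter, Prod.mk.injEq, sub_eq_zero]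
  rw [Finset.sum_neg_distrib, hcard] at hsum
  rw [← hsum]
  simp only [tropicalLineSum, ← Finset.sum_add_distrib, ← Finset.sum_sub_distrib]
  refine Finset.sum_congr rfl fun i _ => ?_
  simp only [sub_sub_eq_add_sub, sub_add_eq_sub_sub, add_sub_right_comm]

/-- A finite family of points in the plane is determined, up to order, by its sum of tropical
lines. -/
lemma exists_perm_of_tropicalLineSum_eq {n : ℕ} {x y x' y' : Fin n → ℝ}
    (h : ∀ p q, tropicalLineSum x y p q = tropicalLineSum x' y' p q) :
    ∃ π : Equiv.Perm (Fin n), ∀ i, x i = x' (π i) ∧ y i = y' (π i) := by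
  have hfiber : ∀ w : ℝ × ℝ,
      Nonempty ({i // (x i, y i) = w} ≃ {i // (x' i, y' i) = w}) := by
    rintro ⟨p, q⟩
    obtain ⟨ε, h1, h2, hε⟩ := ((eventually_tropicalLineSum_difference x y p q).and
      ((eventually_tropicalLineSum_difference x' y' p q).and self_mem_nhdsWithin)).exists
    simp only [h] at h1
    have hε : (0 : ℝ) < ε := hε
    have hcard := Nat.cast_injective
      (mul_right_cancel₀ hε.ne' (neg_injective (h1.symm.trans h2)))
    rw [← Fintype.card_eq, Fintype.card_subtype, Fintype.card_subtype, hcard]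
  exact ⟨Equiv.ofFiberEquiv fun w => (hfiber w).some, fun i => Prod.mk.inj
    (Equiv.ofFiberEquiv_map (g := fun i => (x' i, y' i)) (fun w => (hfiber w).some) i).symm⟩

lemma tropicalLineSum_le_of_sigmaE_le {n : ℕ} {x y x' y' : Fin n → ℝ}
    (h : ∀ E, sigmaE n E x y ≤ sigmaE n E x' y') (p q : ℝ) :
    tropicalLineSum x y p q ≤ tropicalLineSum x' y' p q := by
  have hrow : ∀ i, ∃ e : Bool × Bool, (e = (false, false) ∨ e = (true, false) ∨ e = (false, true)) ∧
      max 0 (max (x i - p) (y i - q))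
        = ((if e.1 then x i else 0) + (if e.2 then y i else 0))
          - ((if e.1 then p else 0) + (if e.2 then q else 0)) := by
    intro i
    rcases max_choice 0 (max (x i - p) (y i - q)) with h1 | h1
    · exact ⟨(false, false), by simp, by simp [h1]⟩
    · rcases max_choice (x i - p) (y i - q) with h2 | h2
      · exact ⟨(true, false), by simp, by rw [h1, h2]; simp⟩
      · exact ⟨(false, true), by simp, by rw [h1, h2]; simp⟩
  choose E hE hval using hrow
  have hlow : ∑ i, ((if (E i).1 then x i else 0) + (if (E i).2 then y i else 0))
      ≤ sigmaE n E x y :=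
    le_ciSup (f := fun π : Equiv.Perm (Fin n) =>
      ∑ i, ((if (E i).1 then x (π i) else 0) + (if (E i).2 then y (π i) else 0)))
      (Set.finite_range _).bddAbove 1
  have hup : sigmaE n E x' y' ≤ tropicalLineSum x' y' p q
      + ∑ i, ((if (E i).1 then p else 0) + (if (E i).2 then q else 0)) := by
    refine ciSup_le fun π => ?_
    rw [tropicalLineSum, ← Equiv.sum_comp π fun j => max 0 (max (x' j - p) (y' j - q)),
      ← Finset.sum_add_distrib]
    refine Finset.sum_le_sum fun i _ => ?_
    have h0 := le_max_left 0 (max (x' (π i) - p) (y' (π i) - q))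
    have h1 := le_max_right 0 (max (x' (π i) - p) (y' (π i) - q))
    have h2 := (le_max_left (x' (π i) - p) (y' (π i) - q)).trans h1
    have h3 := (le_max_right (x' (π i) - p) (y' (π i) - q)).trans h1
    rcases hE i with e | e | e <;> simp only [e, if_true, Bool.false_eq_true, if_false] <;>
      linarith
  calc tropicalLineSum x y p q
      = ∑ i, ((if (E i).1 then x i else 0) + (if (E i).2 then y i else 0))
        - ∑ i, ((if (E i).1 then p else 0) + (if (E i).2 then q else 0)) := by
        rw [tropicalLineSum, ← Finset.sum_sub_distrib]
        exact Finset.sum_congr rfl fun i _ => hval i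
    _ ≤ tropicalLineSum x' y' p q := by linarith [h E]

open Filter in
lemma eventually_min_natCast_mul (x d : ℝ) :
    ∀ᶠ m : ℕ in atTop, 0 < d → min x (m * d) = x := by
  by_cases hd : 0 < d
  · filter_upwards [(tendsto_natCast_atTop_atTop (R := ℝ)).eventually_ge_atTop (x / d)] with m hm _
    exact min_eq_left ((div_le_iff₀ hd).mp hm)
  · simp [hd]

/-- The functions `E_{m,E}` separate nonequivalent points of `[0,∞)^{2n}`. -/
theorem EmE_separates_points (n : ℕ) (hn : 1 ≤ n) (x d x' d' : Fin n → ℝ)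
    (hx : ∀ j, 0 ≤ x j) (hd : ∀ j, 0 ≤ d j)
    (hx' : ∀ j, 0 ≤ x' j) (hd' : ∀ j, 0 ≤ d' j)
    (h : ∀ m : ℕ, 1 ≤ m → ∀ E : Fin n → Bool × Bool, (∃ i, E i ≠ (false, false)) →
      EmE n m E x d = EmE n m E x' d') :
    EquivBar n x d x' d' := by
  obtain ⟨m, hm, hxm, hxm'⟩ := ((Filter.eventually_ge_atTop 1).and
    ((Filter.eventually_all.mpr fun i => eventually_min_natCast_mul (x i) (d i)).and
      (Filter.eventually_all.mpr fun i => eventually_min_natCast_mul (x' i) (d' i)))).exists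
  have hσ : ∀ E, EmE n m E x d = EmE n m E x' d' := by
    intro E
    by_cases hE : ∃ i, E i ≠ (false, false)
    · exact h m hm E hE
    · push Not at hE
      simp [EmE, sigmaE, hE]
  obtain ⟨π, hπ⟩ := exists_perm_of_tropicalLineSum_eq fun p q => le_antisymm
    (tropicalLineSum_le_of_sigmaE_le (fun E => (hσ E).le) p q)
    (tropicalLineSum_le_of_sigmaE_le (fun E => (hσ E).ge) p q)
  refine ⟨π, fun i => (hπ i).2, fun i hi => ?_⟩
  rw [← hxm i hi, (hπ i).1, hxm' (π i) ((hπ i).2 ▸ hi)]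
end

section
/- Bottleneck stability of the tropical rational coordinates: let k, l, p be nonnegative integers with k + l + p ≥ 1, let m be a positive integer, and set M = max(1, m). Then for every pair of barcodes B_1 and B_2, |E_{m,k,l,p}(B_1) − E_{m,k,l,p}(B_2)| ≤ 2(2pM + 2p + 2kM + 2l) · d_∞(B_1, B_2). -/
/-- The tropical rational coordinate `E_{m,k,l,p}` on barcodes: pad the barcode `B`
with zero intervals `(0,0)` so that it has at least `k + l + p` intervals, and take the
maximum, over all choices of `p + k + l` pairwise distinct intervals
`(x_1, d_1), …, (x_{p+k+l}, d_{p+k+l})` of the padded barcode, of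
`Σ_{i=1}^{p} (min(x_i, m·d_i) + d_i) + Σ_{i=p+1}^{p+k} min(x_i, m·d_i)
  + Σ_{i=p+k+1}^{p+k+l} d_i`. -/
noncomputable def Efun (m k l p : ℕ) (B : Multiset (ℝ × ℝ)) : ℝ :=
  sSup { r | ∃ S₁ S₂ S₃ : Multiset (ℝ × ℝ),
    S₁.card = p ∧ S₂.card = k ∧ S₃.card = l ∧
    S₁ + S₂ + S₃ ≤ B + Multiset.replicate (p + k + l) ((0 : ℝ), (0 : ℝ)) ∧
    r = (S₁.map fun I : ℝ × ℝ => min I.1 ((m : ℝ) * I.2) + I.2).sum +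
        (S₂.map fun I : ℝ × ℝ => min I.1 ((m : ℝ) * I.2)).sum +
        (S₃.map fun I : ℝ × ℝ => I.2).sum }

theorem le_fold_max_and_forall_mem_le (s : Multiset ℝ) (b : ℝ) :
    b ≤ s.fold max b ∧ ∀ x ∈ s, x ≤ s.fold max b := by
  induction s using Multiset.induction_on with
  | empty => simp
  | cons a s ih =>
    rw [Multiset.fold_cons_left]
    refine ⟨ih.1.trans (le_max_right _ _), fun x hx => ?_⟩
    rcases Multiset.mem_cons.1 hx with rfl | hx
    · exact le_max_left _ _
    · exact (ih.2 x hx).trans (le_max_right _ _)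

theorem Multiset.Rel.sum_map_le_add {α β : Type*} {R : α → β → Prop} {f : α → ℝ} {g : β → ℝ}
    {c : ℝ} (hR : ∀ a b, R a b → f a ≤ g b + c) {s : Multiset α} {t : Multiset β}
    (h : Multiset.Rel R s t) : (s.map f).sum ≤ (t.map g).sum + s.card * c := by
  induction h with
  | zero => simp
  | cons hab _ ih =>
    simp only [Multiset.map_cons, Multiset.sum_cons, Multiset.card_cons, Nat.cast_add,
      Nat.cast_one]
    linarith [hR _ _ hab]

theorem Multiset.rel_map_map_of_mem {α β γ : Type*} {R : β → γ → Prop} {f : α → β}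
    {g : α → γ} {s : Multiset α} (h : ∀ a ∈ s, R (f a) (g a)) : Multiset.Rel R (s.map f) (s.map g) := by
  rw [Multiset.rel_map]
  exact Multiset.rel_refl_of_refl_on h

theorem Multiset.le_add_replicate_card {α : Type*} [DecidableEq α] {s t : Multiset α} {a : α}
    {N : ℕ} (h : s ≤ t + Multiset.replicate N a) :
    s ≤ t + Multiset.replicate s.card a := by
  rw [Multiset.le_iff_count] at h ⊢
  intro b
  have hb := h b
  have hc := Multiset.count_le_card b s
  simp only [Multiset.count_add, Multiset.count_replicate] at hb ⊢
  split_ifs at hb ⊢ <;> omega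

/-- The values over which the supremum defining `Efun` is taken. -/
def EfunValues (m k l p : ℕ) (B : Multiset (ℝ × ℝ)) : Set ℝ :=
  { r | ∃ S₁ S₂ S₃ : Multiset (ℝ × ℝ),
    S₁.card = p ∧ S₂.card = k ∧ S₃.card = l ∧
    S₁ + S₂ + S₃ ≤ B + Multiset.replicate (p + k + l) ((0 : ℝ), (0 : ℝ)) ∧
    r = (S₁.map fun I : ℝ × ℝ => min I.1 ((m : ℝ) * I.2) + I.2).sum +
        (S₂.map fun I : ℝ × ℝ => min I.1 ((m : ℝ) * I.2)).sum +
        (S₃.map fun I : ℝ × ℝ => I.2).sum }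

theorem Efun_eq_sSup_EfunValues (m k l p : ℕ) (B : Multiset (ℝ × ℝ)) :
    Efun m k l p B = sSup (EfunValues m k l p B) := rfl

theorem EfunValues_nonempty (m k l p : ℕ) (B : Multiset (ℝ × ℝ)) :
    (EfunValues m k l p B).Nonempty := by
  refine ⟨_, Multiset.replicate p (0, 0), Multiset.replicate k (0, 0),
    Multiset.replicate l (0, 0), by simp, by simp, by simp, ?_, rfl⟩
  rw [← Multiset.replicate_add, ← Multiset.replicate_add]
  exact Multiset.le_add_left _ _

theorem EfunValues_finite (m k l p : ℕ) (B : Multiset (ℝ × ℝ)) :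
    (EfunValues m k l p B).Finite := by
  have hP := Set.finite_Iic (B + Multiset.replicate (p + k + l) ((0 : ℝ), (0 : ℝ)))
  refine ((hP.prod (hP.prod hP)).image fun S =>
    (S.1.map fun I : ℝ × ℝ => min I.1 ((m : ℝ) * I.2) + I.2).sum +
      (S.2.1.map fun I : ℝ × ℝ => min I.1 ((m : ℝ) * I.2)).sum +
      (S.2.2.map fun I : ℝ × ℝ => I.2).sum).subset ?_
  rintro r ⟨S₁, S₂, S₃, -, -, -, hS, rfl⟩
  refine ⟨(S₁, S₂, S₃), ⟨?_, ?_, ?_⟩, rfl⟩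
  · exact ((Multiset.le_add_right _ _).trans (Multiset.le_add_right _ _)).trans hS
  · exact ((Multiset.le_add_left _ _).trans (Multiset.le_add_right _ _)).trans hS
  · exact (Multiset.le_add_left _ _).trans hS

theorem snd_le_of_intervalDist_le {I J : ℝ × ℝ} {ε : ℝ} (h : intervalDist I J ≤ ε) :
    I.2 ≤ J.2 + 2 * ε := by
  obtain ⟨hx, hy⟩ := max_le_iff.1 h
  rw [abs_le] at hx hy
  linarith [hx.1, hy.2]

theorem min_le_of_intervalDist_le {I J : ℝ × ℝ} {ε : ℝ} (m : ℕ) (h : intervalDist I J ≤ ε) :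
    min I.1 (m * I.2) ≤ min J.1 (m * J.2) + 2 * max (1 : ℝ) m * ε := by
  have hx := abs_le.1 (max_le_iff.1 h).1
  have hε : 0 ≤ ε := (abs_nonneg _).trans (max_le_iff.1 h).1
  have h1 : 1 * ε ≤ max (1 : ℝ) m * ε := mul_le_mul_of_nonneg_right (le_max_left _ _) hε
  have h2 : m * ε ≤ max (1 : ℝ) m * ε := mul_le_mul_of_nonneg_right (le_max_right _ _) hε
  have h3 : (m : ℝ) * I.2 ≤ m * (J.2 + 2 * ε) :=
    mul_le_mul_of_nonneg_left (snd_le_of_intervalDist_le h) m.cast_nonneg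
  rw [← min_add_add_right]
  exact min_le_min (by linarith [hx.2]) (by linarith)

theorem Efun_le_add_of_matching (m k l p : ℕ) {B₁ B₂ : Multiset (ℝ × ℝ)}
    {M : Multiset ((ℝ × ℝ) × (ℝ × ℝ))} (hM : IsMatching B₁ B₂ M) {ε : ℝ} (hε : 0 ≤ ε)
    (hmatched : ∀ IJ ∈ M, intervalDist IJ.1 IJ.2 ≤ ε)
    (hunmatched : ∀ I ∈ B₁ - M.map Prod.fst, I.2 / 2 ≤ ε) :
    Efun m k l p B₁ ≤ Efun m k l p B₂ +
      (2 * p * max (1 : ℝ) m + 2 * p + 2 * k * max (1 : ℝ) m + 2 * l) * ε := by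
  let R : ℝ × ℝ → ℝ × ℝ → Prop := fun I J =>
    I.2 ≤ J.2 + 2 * ε ∧ min I.1 (m * I.2) ≤ min J.1 (m * J.2) + 2 * max (1 : ℝ) m * ε
  have hR₀ : ∀ I : ℝ × ℝ, I.2 ≤ 2 * ε → R I (0, 0) := by
    intro I hI
    have h2 : m * ε ≤ max (1 : ℝ) m * ε := mul_le_mul_of_nonneg_right (le_max_right _ _) hε
    have h3 : (m : ℝ) * I.2 ≤ m * (2 * ε) := mul_le_mul_of_nonneg_left hI m.cast_nonneg
    refine ⟨by simpa using hI, (min_le_right _ _).trans ?_⟩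
    simp only [mul_zero, min_self, zero_add]
    linarith
  set n := p + k + l with hn
  set u := (B₁ - M.map Prod.fst).card
  have hrel : Multiset.Rel R (B₁ + Multiset.replicate n (0, 0))
      (M.map Prod.snd + Multiset.replicate (u + n) (0, 0)) := by
    have hB : B₁ + Multiset.replicate n (0, 0) = M.map Prod.fst +
        ((B₁ - M.map Prod.fst) + Multiset.replicate n (0, 0)) := by
      rw [← add_assoc, add_tsub_cancel_of_le hM.1]
    rw [hB]
    refine Multiset.Rel.add (Multiset.rel_map_map_of_mem fun IJ hIJ =>
      ⟨snd_le_of_intervalDist_le (hmatched IJ hIJ),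
        min_le_of_intervalDist_le m (hmatched IJ hIJ)⟩) ?_
    refine Multiset.rel_replicate_right.2 ⟨by simp [u], fun I hI => hR₀ I ?_⟩
    rcases Multiset.mem_add.1 hI with hI | hI
    · linarith [hunmatched I hI]
    · rw [Multiset.eq_of_mem_replicate hI]
      simpa using hε
  rw [Efun_eq_sSup_EfunValues m k l p B₁]
  refine csSup_le (EfunValues_nonempty m k l p B₁) ?_
  rintro r ⟨S₁, S₂, S₃, h1, h2, h3, hS, rfl⟩
  obtain ⟨U, hU⟩ := Multiset.le_iff_exists_add.1 hS
  rw [hU, Multiset.rel_add_left] at hrel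
  obtain ⟨T, V, hST, -, hTV⟩ := hrel
  have hTn : T.card = n := by
    rw [← Multiset.card_eq_card_of_rel hST, Multiset.card_add, Multiset.card_add, h1, h2, h3]
  have hT : T ≤ B₂ + Multiset.replicate n (0, 0) := by
    rw [← hTn]
    refine Multiset.le_add_replicate_card (N := u + n) ?_
    exact ((Multiset.le_add_right T V).trans hTV.ge).trans (add_le_add_left hM.2 _)
  obtain ⟨T₁₂, T₃, hST₁₂, hST₃, rfl⟩ := Multiset.rel_add_left.1 hST
  obtain ⟨T₁, T₂, hST₁, hST₂, rfl⟩ := Multiset.rel_add_left.1 hST₁₂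
  have hle : _ ≤ Efun m k l p B₂ := le_csSup (EfunValues_finite m k l p B₂).bddAbove
    ⟨T₁, T₂, T₃, (Multiset.card_eq_card_of_rel hST₁).symm.trans h1,
      (Multiset.card_eq_card_of_rel hST₂).symm.trans h2,
      (Multiset.card_eq_card_of_rel hST₃).symm.trans h3, hT, rfl⟩
  have hs₁ := hST₁.sum_map_le_add
    (f := fun I : ℝ × ℝ => min I.1 ((m : ℝ) * I.2) + I.2)
    (g := fun I : ℝ × ℝ => min I.1 ((m : ℝ) * I.2) + I.2)
    (c := 2 * max (1 : ℝ) m * ε + 2 * ε) fun I J h => by linarith [h.1, h.2]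
  have hs₂ := hST₂.sum_map_le_add (f := fun I : ℝ × ℝ => min I.1 ((m : ℝ) * I.2))
    (g := fun I : ℝ × ℝ => min I.1 ((m : ℝ) * I.2)) fun I J h => h.2
  have hs₃ := hST₃.sum_map_le_add (f := fun I : ℝ × ℝ => I.2)
    (g := fun I : ℝ × ℝ => I.2) fun I J h => h.1
  rw [h1] at hs₁
  rw [h2] at hs₂
  rw [h3] at hs₃
  linarith

theorem abs_Efun_sub_le_penaltyInf (m k l p : ℕ) {B₁ B₂ : Multiset (ℝ × ℝ)}
    {M : Multiset ((ℝ × ℝ) × (ℝ × ℝ))} (hM : IsMatching B₁ B₂ M) :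
    |Efun m k l p B₁ - Efun m k l p B₂| ≤
      (2 * p * max (1 : ℝ) m + 2 * p + 2 * k * max (1 : ℝ) m + 2 * l) *
        penaltyInf B₁ B₂ M := by
  obtain ⟨hε, hmem⟩ := le_fold_max_and_forall_mem_le
    ((M.map fun IJ : (ℝ × ℝ) × (ℝ × ℝ) => intervalDist IJ.1 IJ.2) +
      (((B₁ - M.map Prod.fst) + (B₂ - M.map Prod.snd)).map fun I : ℝ × ℝ => I.2 / 2)) 0
  change 0 ≤ penaltyInf B₁ B₂ M at hε
  change ∀ x ∈ _, x ≤ penaltyInf B₁ B₂ M at hmem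
  have hmatched : ∀ IJ ∈ M, intervalDist IJ.1 IJ.2 ≤ penaltyInf B₁ B₂ M := fun IJ hIJ =>
    hmem _ (Multiset.mem_add.2 (Or.inl (Multiset.mem_map_of_mem _ hIJ)))
  have hunmatched : ∀ I ∈ (B₁ - M.map Prod.fst) + (B₂ - M.map Prod.snd),
      I.2 / 2 ≤ penaltyInf B₁ B₂ M := fun I hI =>
    hmem _ (Multiset.mem_add.2 (Or.inr (Multiset.mem_map_of_mem _ hI)))
  have hfst : (M.map Prod.swap).map Prod.fst = M.map Prod.snd := by simp
  have hsnd : (M.map Prod.swap).map Prod.snd = M.map Prod.fst := by simp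
  have h12 := Efun_le_add_of_matching m k l p hM hε hmatched fun I hI =>
    hunmatched I (Multiset.mem_add.2 (Or.inl hI))
  have h21 := Efun_le_add_of_matching m k l p (M := M.map Prod.swap) (B₁ := B₂) (B₂ := B₁)
    ⟨hfst ▸ hM.2, hsnd ▸ hM.1⟩ hε
    (fun IJ hIJ => by
      obtain ⟨JI, hJI, rfl⟩ := Multiset.mem_map.1 hIJ
      rw [intervalDist_comm]
      exact hmatched JI hJI)
    (fun I hI => hunmatched I (Multiset.mem_add.2 (Or.inr (hfst ▸ hI))))
  rw [abs_le]
  constructor <;> linarith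

/-- Bottleneck stability of the tropical rational coordinates `E_{m,k,l,p}`. -/
theorem Efun_bottleneck_stable (k l p : ℕ) (hklp : 1 ≤ k + l + p) (m : ℕ) (hm : 1 ≤ m)
    (B₁ B₂ : Multiset (ℝ × ℝ))
    (h₁ : ∀ I ∈ B₁, 0 ≤ I.1 ∧ 0 ≤ I.2) (h₂ : ∀ I ∈ B₂, 0 ≤ I.1 ∧ 0 ≤ I.2) :
    |Efun m k l p B₁ - Efun m k l p B₂| ≤
      2 * (2 * p * max (1 : ℝ) m + 2 * p + 2 * k * max (1 : ℝ) m + 2 * l) *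
        bottleneckDist B₁ B₂ := by
  have hpos : (0 : ℝ) < 2 * p * max (1 : ℝ) m + 2 * p + 2 * k * max (1 : ℝ) m + 2 * l := by
    have hmax : (1 : ℝ) ≤ max (1 : ℝ) m := le_max_left _ _
    have hsum : (1 : ℝ) ≤ k + l + p := by exact_mod_cast hklp
    have hk : (k : ℝ) * 1 ≤ k * max (1 : ℝ) m := mul_le_mul_of_nonneg_left hmax k.cast_nonneg
    have hp : (0 : ℝ) ≤ p * max (1 : ℝ) m := by positivity
    linarith
  set C := 2 * p * max (1 : ℝ) m + 2 * p + 2 * k * max (1 : ℝ) m + 2 * l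
  have hdist : |Efun m k l p B₁ - Efun m k l p B₂| / C ≤ bottleneckDist B₁ B₂ := by
    refine le_csInf ⟨_, 0, by simp [IsMatching], rfl⟩ ?_
    rintro r ⟨M, hM, rfl⟩
    rw [div_le_iff₀' hpos]
    exact abs_Efun_sub_le_penaltyInf m k l p hM
  rw [div_le_iff₀' hpos] at hdist
  linarith [abs_nonneg (Efun m k l p B₁ - Efun m k l p B₂)]
end

section
/- Wasserstein stability of the tropical rational coordinates: let k, l, p be nonnegative integers with k + l + p ≥ 1, let m be a positive integer, set M = max(1, m), and let q ≥ 1 be a real number. Then for every pair of barcodes B_1 and B_2, |E_{m,k,l,p}(B_1) − E_{m,k,l,p}(B_2)| ≤ 2(2pM + 2p + 2kM + 2l)^2 · d_q(B_1, B_2). -/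
theorem Multiset.Rel.sum_map_le {α : Type*} {R : α → α → Prop} {S T : Multiset α}
    (h : Multiset.Rel R S T) (f : α → ℝ) (c : ℝ) (hf : ∀ I J, R I J → f I ≤ f J + c) :
    (S.map f).sum ≤ (T.map f).sum + S.card * c := by
  induction h with
  | zero => simp
  | cons hab _ ih =>
    have := hf _ _ hab
    simp only [Multiset.map_cons, Multiset.sum_cons, Multiset.card_cons, Nat.cast_add, Nat.cast_one]
    linarith

theorem Efun_bddAbove (m k l p : ℕ) (B : Multiset (ℝ × ℝ)) :
    BddAbove { r | ∃ S₁ S₂ S₃ : Multiset (ℝ × ℝ),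
      S₁.card = p ∧ S₂.card = k ∧ S₃.card = l ∧
      S₁ + S₂ + S₃ ≤ B + Multiset.replicate (p + k + l) ((0 : ℝ), (0 : ℝ)) ∧
      r = (S₁.map fun I : ℝ × ℝ => min I.1 ((m : ℝ) * I.2) + I.2).sum +
          (S₂.map fun I : ℝ × ℝ => min I.1 ((m : ℝ) * I.2)).sum +
          (S₃.map fun I : ℝ × ℝ => I.2).sum } := by
  have hfin := Set.finite_Iic (B + Multiset.replicate (p + k + l) ((0 : ℝ), (0 : ℝ)))
  refine (((hfin.prod (hfin.prod hfin)).image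
    fun S : Multiset (ℝ × ℝ) × Multiset (ℝ × ℝ) × Multiset (ℝ × ℝ) =>
      (S.1.map fun I : ℝ × ℝ => min I.1 ((m : ℝ) * I.2) + I.2).sum +
        (S.2.1.map fun I : ℝ × ℝ => min I.1 ((m : ℝ) * I.2)).sum +
        (S.2.2.map fun I : ℝ × ℝ => I.2).sum).subset ?_).bddAbove
  rintro r ⟨S₁, S₂, S₃, -, -, -, hS, rfl⟩
  refine ⟨(S₁, S₂, S₃), ⟨?_, ?_, ?_⟩, rfl⟩
  · exact (Multiset.le_add_right _ _).trans ((Multiset.le_add_right _ _).trans hS)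
  · exact (Multiset.le_add_left _ _).trans ((Multiset.le_add_right _ _).trans hS)
  · exact (Multiset.le_add_left _ _).trans hS

/-- A selection from a padded barcode can be transported along a matching, sending the
unmatched intervals to zero intervals. -/
theorem exists_rel_le_padded {α : Type*} {R : α → α → Prop} {z : α}
    {A A' U U' S : Multiset α} (hA : Multiset.Rel R A A')
    (hU : ∀ I ∈ U, R I z) (hz : R z z)
    (hS : S ≤ A + U + Multiset.replicate S.card z) :
    ∃ T, Multiset.Rel R S T ∧ T ≤ A' + U' + Multiset.replicate S.card z := by
  classical
  have hsub : S - A ≤ U + Multiset.replicate S.card z := by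
    rw [tsub_le_iff_left, ← add_assoc]
    exact hS
  have hsplit : S - A + S ∩ A = S := Multiset.sub_add_inter S A
  obtain ⟨X, hX⟩ := Multiset.le_iff_exists_add.1 (Multiset.inter_le_right : S ∩ A ≤ A)
  rw [hX, Multiset.rel_add_left] at hA
  obtain ⟨T', X', hT', -, rfl⟩ := hA
  refine ⟨Multiset.replicate (S - A).card z + T', ?_, ?_⟩
  · nth_rewrite 1 [← hsplit]
    refine Multiset.Rel.add (Multiset.rel_replicate_right.2 ⟨rfl, fun I hI => ?_⟩) hT'
    rcases Multiset.mem_add.1 (Multiset.mem_of_le hsub hI) with h | h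
    · exact hU I h
    · rw [Multiset.eq_of_mem_replicate h]
      exact hz
  · rw [add_comm]
    refine add_le_add ?_ ?_
    · rw [add_assoc]
      exact Multiset.le_add_right _ _
    · exact Multiset.replicate_le_replicate z |>.2 (Multiset.card_le_card tsub_le_self)

theorem abs_length_sub_le {I J : ℝ × ℝ} {e : ℝ} (h : intervalDist I J ≤ e) :
    |I.2 - J.2| ≤ 2 * e := by
  obtain ⟨h1, h2⟩ := max_le_iff.1 h
  rw [abs_le] at *
  constructor <;> linarith

theorem min_le_min_add_of_intervalDist_le {I J : ℝ × ℝ} {e : ℝ} (h : intervalDist I J ≤ e)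
    (m : ℝ) (hm : 0 ≤ m) : min I.1 (m * I.2) ≤ min J.1 (m * J.2) + 2 * max 1 m * e := by
  have hd := (abs_le.1 (abs_length_sub_le h)).2
  have h1 := (max_le_iff.1 h).1
  have he : 0 ≤ e := (abs_nonneg _).trans h1
  have hx := (abs_le.1 h1).2
  have hM1 : 1 * e ≤ max 1 m * e := mul_le_mul_of_nonneg_right (le_max_left _ _) he
  have hMm : m * e ≤ max 1 m * e := mul_le_mul_of_nonneg_right (le_max_right _ _) he
  have hmd : m * (I.2 - J.2) ≤ m * (2 * e) := mul_le_mul_of_nonneg_left hd hm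
  rw [← sub_le_iff_le_add]
  refine le_min ?_ ?_
  · linarith [min_le_left I.1 (m * I.2)]
  · linarith [min_le_right I.1 (m * I.2)]

theorem Efun_le_add_of_rel (m k l p : ℕ) {e : ℝ} (he : 0 ≤ e) {A A' U U' : Multiset (ℝ × ℝ)}
    (hA : Multiset.Rel (fun I J => intervalDist I J ≤ e) A A') (hU : ∀ I ∈ U, I.2 / 2 ≤ e) :
    Efun m k l p (A + U) ≤ Efun m k l p (A' + U') +
      (2 * p * max (1 : ℝ) m + 2 * p + 2 * k * max (1 : ℝ) m + 2 * l) * e := by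
  have hm : (0 : ℝ) ≤ m := Nat.cast_nonneg m
  set R : ℝ × ℝ → ℝ × ℝ → Prop := fun I J =>
    min I.1 ((m : ℝ) * I.2) ≤ min J.1 ((m : ℝ) * J.2) + 2 * max 1 (m : ℝ) * e ∧
      I.2 ≤ J.2 + 2 * e
  have hM : 0 ≤ max 1 (m : ℝ) * e := mul_nonneg (hm.trans (le_max_right _ _)) he
  have hAR : Multiset.Rel R A A' := hA.mono fun I _ J _ h =>
    ⟨min_le_min_add_of_intervalDist_le h m hm,
      by linarith [(abs_le.1 (abs_length_sub_le h)).2]⟩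
  have hUR : ∀ I ∈ U, R I (0, 0) := fun I hI => by
    have h := hU I hI
    have hmd : (m : ℝ) * (I.2 / 2) ≤ m * e := mul_le_mul_of_nonneg_left h hm
    have hMm : m * e ≤ max 1 (m : ℝ) * e := mul_le_mul_of_nonneg_right (le_max_right _ _) he
    refine ⟨?_, by simp only; linarith⟩
    simp only [mul_zero, min_self]
    linarith [min_le_right I.1 (m * I.2)]
  have hzR : R (0, 0) (0, 0) := by
    constructor <;> simp only [mul_zero, min_self] <;> linarith
  refine csSup_le ?_ ?_
  · refine ⟨_, Multiset.replicate p (0, 0), Multiset.replicate k (0, 0),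
      Multiset.replicate l (0, 0), by simp, by simp, by simp, ?_, rfl⟩
    rw [← Multiset.replicate_add, ← Multiset.replicate_add]
    exact Multiset.le_add_left _ _
  · rintro r ⟨S₁, S₂, S₃, rfl, rfl, rfl, hS, rfl⟩
    rw [← Multiset.card_add, ← Multiset.card_add] at hS
    obtain ⟨T, hST, hT⟩ := exists_rel_le_padded (U' := U') hAR hUR hzR hS
    rw [Multiset.rel_add_left] at hST
    obtain ⟨T₁₂, T₃, hST₁₂, h3, rfl⟩ := hST
    rw [Multiset.rel_add_left] at hST₁₂
    obtain ⟨T₁, T₂, h1, h2, rfl⟩ := hST₁₂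
    rw [Multiset.card_add, Multiset.card_add] at hT
    have hle := le_csSup (Efun_bddAbove m S₂.card S₃.card S₁.card (A' + U'))
      ⟨T₁, T₂, T₃, (Multiset.card_eq_card_of_rel h1).symm,
        (Multiset.card_eq_card_of_rel h2).symm, (Multiset.card_eq_card_of_rel h3).symm, hT, rfl⟩
    have b1 := h1.sum_map_le (fun I : ℝ × ℝ => min I.1 ((m : ℝ) * I.2) + I.2)
      (2 * max 1 (m : ℝ) * e + 2 * e) fun I J h => by
        have := h.1
        have := h.2
        linarith
    have b2 := h2.sum_map_le (fun I : ℝ × ℝ => min I.1 ((m : ℝ) * I.2))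
      (2 * max 1 (m : ℝ) * e) fun I J h => h.1
    have b3 := h3.sum_map_le (fun I : ℝ × ℝ => I.2) (2 * e) fun I J h => h.2
    change _ ≤ Efun m S₂.card S₃.card S₁.card (A' + U') at hle
    linarith

theorem le_rpow_one_div_of_rpow_le {x y q : ℝ} (hx : 0 ≤ x) (hq : 0 < q) (h : x ^ q ≤ y) :
    x ≤ y ^ (1 / q) := by
  rw [one_div]
  exact (Real.le_rpow_inv_iff_of_pos hx ((Real.rpow_nonneg hx q).trans h) hq).2 h

theorem abs_Efun_sub_le_of_isMatching (k l p m : ℕ) {q : ℝ} (hq : 0 < q)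
    {B₁ B₂ : Multiset (ℝ × ℝ)} (h₁ : ∀ I ∈ B₁, 0 ≤ I.2) (h₂ : ∀ I ∈ B₂, 0 ≤ I.2)
    {M : Multiset ((ℝ × ℝ) × (ℝ × ℝ))} (hM : IsMatching B₁ B₂ M) :
    0 ≤ penaltyP q B₁ B₂ M ∧
    |Efun m k l p B₁ - Efun m k l p B₂| ≤
      (2 * p * max (1 : ℝ) m + 2 * p + 2 * k * max (1 : ℝ) m + 2 * l) *
        penaltyP q B₁ B₂ M ^ (1 / q) := by
  have hU : ∀ I ∈ (B₁ - M.map Prod.fst) + (B₂ - M.map Prod.snd), 0 ≤ I.2 := fun I hI => by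
    rcases Multiset.mem_add.1 hI with h | h
    · exact h₁ I (Multiset.mem_of_le tsub_le_self h)
    · exact h₂ I (Multiset.mem_of_le tsub_le_self h)
  have hn1 : ∀ x ∈ M.map fun IJ : (ℝ × ℝ) × (ℝ × ℝ) => intervalDist IJ.1 IJ.2 ^ q, 0 ≤ x := by
    intro x hx
    obtain ⟨IJ, -, rfl⟩ := Multiset.mem_map.1 hx
    exact Real.rpow_nonneg (intervalDist_nonneg _ _) q
  have hn2 : ∀ x ∈ ((B₁ - M.map Prod.fst) + (B₂ - M.map Prod.snd)).map
      fun I : ℝ × ℝ => (I.2 / 2) ^ q, 0 ≤ x := by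
    intro x hx
    obtain ⟨I, hI, rfl⟩ := Multiset.mem_map.1 hx
    exact Real.rpow_nonneg (div_nonneg (hU I hI) zero_le_two) q
  have hs1 := Multiset.sum_nonneg hn1
  have hs2 := Multiset.sum_nonneg hn2
  have hP : 0 ≤ penaltyP q B₁ B₂ M := add_nonneg hs1 hs2
  refine ⟨hP, ?_⟩
  set e := penaltyP q B₁ B₂ M ^ (1 / q)
  have he : 0 ≤ e := Real.rpow_nonneg hP _
  have hd : ∀ IJ ∈ M, intervalDist IJ.1 IJ.2 ≤ e := fun IJ hIJ => by
    refine le_rpow_one_div_of_rpow_le (intervalDist_nonneg _ _) hq ?_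
    exact (Multiset.single_le_sum hn1 _ (Multiset.mem_map_of_mem _ hIJ)).trans
      (le_add_of_nonneg_right hs2)
  have hu : ∀ I ∈ (B₁ - M.map Prod.fst) + (B₂ - M.map Prod.snd), I.2 / 2 ≤ e := fun I hI => by
    refine le_rpow_one_div_of_rpow_le (div_nonneg (hU I hI) zero_le_two) hq ?_
    exact (Multiset.single_le_sum hn2 _
      (Multiset.mem_map_of_mem (fun I : ℝ × ℝ => (I.2 / 2) ^ q) hI)).trans
      (le_add_of_nonneg_left hs1)
  have hrel : Multiset.Rel (fun I J => intervalDist I J ≤ e) (M.map Prod.fst) (M.map Prod.snd) :=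
    Multiset.rel_map.2 (Multiset.rel_refl_of_refl_on hd)
  have hrel' : Multiset.Rel (fun I J => intervalDist I J ≤ e) (M.map Prod.snd) (M.map Prod.fst) :=
    (Multiset.rel_flip.2 hrel).mono fun I _ J _ h => by
      rw [intervalDist_comm]
      exact h
  have hle := Efun_le_add_of_rel m k l p he (U' := B₂ - M.map Prod.snd) hrel
    fun I hI => hu I (Multiset.mem_add.2 (Or.inl hI))
  have hge := Efun_le_add_of_rel m k l p he (U' := B₁ - M.map Prod.fst) hrel'
    fun I hI => hu I (Multiset.mem_add.2 (Or.inr hI))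
  rw [add_tsub_cancel_of_le hM.1, add_tsub_cancel_of_le hM.2] at hle hge
  rw [abs_le]
  constructor <;> linarith

/-- Wasserstein stability of the tropical rational coordinates `E_{m,k,l,p}`. -/
theorem Efun_wasserstein_stable (k l p : ℕ) (hklp : 1 ≤ k + l + p) (m : ℕ) (hm : 1 ≤ m)
    (q : ℝ) (hq : 1 ≤ q) (B₁ B₂ : Multiset (ℝ × ℝ))
    (h₁ : ∀ I ∈ B₁, 0 ≤ I.1 ∧ 0 ≤ I.2) (h₂ : ∀ I ∈ B₂, 0 ≤ I.1 ∧ 0 ≤ I.2) :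
    |Efun m k l p B₁ - Efun m k l p B₂| ≤
      2 * (2 * p * max (1 : ℝ) m + 2 * p + 2 * k * max (1 : ℝ) m + 2 * l) ^ 2 *
        wassersteinDist q B₁ B₂ := by
  have hq0 : 0 < q := one_pos.trans_le hq
  have key := fun M (hM : IsMatching B₁ B₂ M) => abs_Efun_sub_le_of_isMatching k l p m hq0
    (fun I hI => (h₁ I hI).2) (fun I hI => (h₂ I hI).2) hM
  set C : ℝ := 2 * p * max (1 : ℝ) m + 2 * p + 2 * k * max (1 : ℝ) m + 2 * l
  have hC1 : 1 ≤ C := by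
    have hcast : (1 : ℝ) ≤ k + l + p := by exact_mod_cast hklp
    have hk : (k : ℝ) * 1 ≤ k * max (1 : ℝ) m :=
      mul_le_mul_of_nonneg_left (le_max_left _ _) (Nat.cast_nonneg k)
    have hp : (p : ℝ) * 1 ≤ p * max (1 : ℝ) m :=
      mul_le_mul_of_nonneg_left (le_max_left _ _) (Nat.cast_nonneg p)
    have hp0 : (0 : ℝ) ≤ p := Nat.cast_nonneg p
    linarith
  have hC0 : 0 < C := one_pos.trans_le hC1
  set D := |Efun m k l p B₁ - Efun m k l p B₂|
  have hDC : 0 ≤ D / C := div_nonneg (abs_nonneg _) hC0.le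
  have hinf : (D / C) ^ q ≤ sInf { r | ∃ M, IsMatching B₁ B₂ M ∧ r = penaltyP q B₁ B₂ M } := by
    refine le_csInf ⟨_, 0, ⟨by simp, by simp⟩, rfl⟩ ?_
    rintro r ⟨M, hM, rfl⟩
    obtain ⟨hP, hle⟩ := key M hM
    rw [← div_le_iff₀' hC0, one_div] at hle
    exact (Real.le_rpow_inv_iff_of_pos hDC hP hq0).1 hle
  have hW : D / C ≤ wassersteinDist q B₁ B₂ := le_rpow_one_div_of_rpow_le hDC hq0 hinf
  calc D ≤ C * wassersteinDist q B₁ B₂ := (div_le_iff₀' hC0).1 hW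
    _ ≤ 2 * C ^ 2 * wassersteinDist q B₁ B₂ :=
      mul_le_mul_of_nonneg_right (by nlinarith) (hDC.trans hW)
end
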